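/- arXiv:1606.00395 — 17 statements merged into one kernel-verified Lean document; each statement's English description precedes it below -/
import Mathlib

section
/- Let n be a positive integer and λ an infinite cardinal. Let S be a T1 topological space equipped with a semilattice (commutative idempotent) operation that is separately continuous, and suppose e : exp_n λ → S is an injective semilattice homomorphism (e(x ∩ y) = e(x)·e(y) for all x, y ∈ exp_n λ). Then the image e(exp_n λ) is a closed subset of S. -/
open Set Filter Topology TopologicalSpace

/-- `Expn Λ n` is the semilattice `exp_n λ`: all subsets of `λ` of cardinality at most `n`. -/
abbrev Expn (Λ : Type*) [DecidableEq Λ] (n : ℕ) := {s : Finset Λ // s.card ≤ n}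

/-- The semilattice operation on `exp_n λ`: intersection. -/
def Expn.inter {Λ : Type*} [DecidableEq Λ] {n : ℕ} (a b : Expn Λ n) : Expn Λ n :=
  ⟨a.1 ∩ b.1, le_trans (Finset.card_le_card Finset.inter_subset_left) a.2⟩

/-- The upper set `↑x = {y ∈ exp_n λ : x ⊆ y}`. -/
def Expn.up {Λ : Type*} [DecidableEq Λ] {n : ℕ} (x : Expn Λ n) : Set (Expn Λ n) :=
  {y | x.1 ⊆ y.1}

/-- Along an ultrafilter on `exp_n λ`, the trace on each finite set is eventually equal to the trace
of one fixed element. -/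
theorem Expn.exists_eventually_inter_eq {Λ : Type*} [DecidableEq Λ] {n : ℕ}
    (F : Ultrafilter (Expn Λ n)) :
    ∃ A : Expn Λ n, ∀ a : Finset Λ, ∀ᶠ y in (F : Filter (Expn Λ n)), a ∩ y.1 = a ∩ A.1 := by
  let P : ℕ → Prop := fun k =>
    ∃ B : Expn Λ n, B.1.card = k ∧ ∀ᶠ y in (F : Filter (Expn Λ n)), B.1 ⊆ y.1
  classical
  have hP0 : P 0 := ⟨⟨∅, by simp⟩, by simp, by simp⟩
  obtain ⟨A, hAcard, hA⟩ := Nat.findGreatest_spec (P := P) (Nat.zero_le n) hP0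
  have hnotMem : ∀ i ∉ A.1, ∀ᶠ y in (F : Filter (Expn Λ n)), i ∉ y.1 := by
    intro i hi
    rw [Ultrafilter.eventually_not]
    intro hmem
    have hins : ∀ᶠ y in (F : Filter (Expn Λ n)), insert i A.1 ⊆ y.1 := by
      filter_upwards [hA, hmem] with y h₁ h₂ using Finset.insert_subset h₂ h₁
    obtain ⟨y, hy⟩ := hins.exists
    have hcard : (insert i A.1).card ≤ n := (Finset.card_le_card hy).trans y.2
    have hle := Nat.le_findGreatest (P := P) hcard ⟨⟨insert i A.1, hcard⟩, rfl, hins⟩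
    rw [Finset.card_insert_of_notMem hi] at hle
    omega
  refine ⟨A, fun a => ?_⟩
  have hall : ∀ᶠ y in (F : Filter (Expn Λ n)), ∀ i ∈ a, i ∉ A.1 → i ∉ y.1 := by
    rw [Filter.eventually_all_finset]
    intro i _
    by_cases hi : i ∈ A.1
    · simp [hi]
    · simpa [hi] using hnotMem i hi
  filter_upwards [hA, hall] with y h₁ h₂
  ext i
  have := @h₁ i
  have := h₂ i
  simp only [Finset.mem_inter]
  tauto

/-- The image of `exp_n λ` under an injective semilattice homomorphism into a
`T1` semitopological semilattice `S` is closed in `S`. -/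
theorem expn_image_closed_in_T1_semitopological_semilattice
    {Λ : Type*} [DecidableEq Λ] [Infinite Λ] (n : ℕ) (hn : 0 < n)
    (S : Type*) [TopologicalSpace S] [T1Space S]
    (m : S → S → S)
    (hcomm : ∀ a b, m a b = m b a)
    (hassoc : ∀ a b c, m (m a b) c = m a (m b c))
    (hidem : ∀ a, m a a = a)
    (hsep : ∀ a, Continuous (m a))
    (e : Expn Λ n → S)
    (hinj : Function.Injective e)
    (hhom : ∀ a b, e (Expn.inter a b) = m (e a) (e b)) :
    IsClosed (Set.range e) := by
  refine isClosed_of_closure_subset fun x hx => ?_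
  have hne : (comap e (𝓝 x)).NeBot := by
    rw [comap_neBot_iff_frequently]
    exact mem_closure_iff_frequently.mp hx
  let F : Ultrafilter (Expn Λ n) := Ultrafilter.of (comap e (𝓝 x))
  have hF : Tendsto e F (𝓝 x) := tendsto_comap.mono_left (Ultrafilter.of_le _)
  obtain ⟨A, hA⟩ := Expn.exists_eventually_inter_eq F
  have hmul : ∀ a : Expn Λ n, m (e a) x = e (Expn.inter a A) := by
    intro a
    have hlim : Tendsto (fun y => m (e a) (e y)) F (𝓝 (m (e a) x)) :=
      ((hsep (e a)).tendsto x).comp hF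
    have hconst : (fun y => m (e a) (e y)) =ᶠ[F] fun _ => e (Expn.inter a A) := by
      filter_upwards [hA a.1] with y hy
      rw [← hhom]
      exact congrArg e (Subtype.ext hy)
    exact (tendsto_const_nhds_iff.mp (hlim.congr' hconst)).symm
  have hlim : Tendsto (fun y => m x (e y)) F (𝓝 x) := by
    simpa only [Function.comp_def, hidem] using ((hsep x).tendsto x).comp hF
  have hconst : (fun y => m x (e y)) =ᶠ[F] fun _ => e A := by
    filter_upwards [hA A.1] with y hy
    rw [hcomm, hmul]
    refine congrArg e (Subtype.ext ?_)
    change y.1 ∩ A.1 = A.1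
    rw [Finset.inter_comm, hy, Finset.inter_self]
  exact ⟨A, tendsto_const_nhds_iff.mp (hlim.congr' hconst)⟩
end

section
/- Let n be a positive integer and λ an infinite cardinal, and let τ be a T1 topology on exp_n λ such that the operation (x, y) ↦ x ∩ y is separately continuous. Then for every x ∈ exp_n λ there exists an open neighbourhood U of x in (exp_n λ, τ) such that U ⊆ ↑x. -/
open Set Filter Topology TopologicalSpace

/-- In a `T1` semitopological semilattice topology on `exp_n λ`, every point `x`
has an open neighbourhood contained in `↑x`. -/
theorem exists_open_nhd_subset_up
    {Λ : Type*} [DecidableEq Λ] [Infinite Λ] (n : ℕ) (hn : 0 < n)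
    [TopologicalSpace (Expn Λ n)] [T1Space (Expn Λ n)]
    (hsep : ∀ a : Expn Λ n, Continuous (Expn.inter a)) :
    ∀ x : Expn Λ n, ∃ U : Set (Expn Λ n), IsOpen U ∧ x ∈ U ∧ U ⊆ Expn.up x := by
  intro x
  have hfin : {z : Expn Λ n | z.1 ⊂ x.1}.Finite :=
    x.1.ssubsets.finite_toSet.preimage Subtype.val_injective.injOn |>.subset
      fun _ hz => Finset.mem_coe.2 (Finset.mem_ssubsets.2 hz)
  refine ⟨Expn.inter x ⁻¹' {z | z.1 ⊂ x.1}ᶜ, hfin.isClosed.isOpen_compl.preimage (hsep x),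
    ?_, fun y hy => ?_⟩
  · simp [Expn.inter]
  · by_contra hxy
    exact hy (Finset.inter_subset_left.ssubset_of_not_subset
      fun h => hxy (h.trans Finset.inter_subset_right))
end

section
/- Let n be a positive integer and λ an infinite cardinal, and let τ be a T1 topology on exp_n λ such that the operation (x, y) ↦ x ∩ y is separately continuous. Then for every x ∈ exp_n λ the upper set ↑x is both open and closed in (exp_n λ, τ). -/
open Set Filter Topology TopologicalSpace

theorem Expn.inter_eq_left_iff {Λ : Type*} [DecidableEq Λ] {n : ℕ} {x y : Expn Λ n} :
    Expn.inter x y = x ↔ y ∈ Expn.up x := by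
  simp [Expn.inter, Expn.up, Subtype.ext_iff]

theorem Expn.finite_setOf_ssubset {Λ : Type*} [DecidableEq Λ] {n : ℕ} (x : Expn Λ n) :
    {z : Expn Λ n | z.1 ⊂ x.1}.Finite :=
  (x.1.ssubsets.finite_toSet.preimage Subtype.val_injective.injOn).subset fun _ hz => by
    simpa using hz

theorem Expn.inter_ssubset_iff {Λ : Type*} [DecidableEq Λ] {n : ℕ} {x y : Expn Λ n} :
    (Expn.inter x y).1 ⊂ x.1 ↔ y ∉ Expn.up x := by
  rw [← Expn.inter_eq_left_iff, Subtype.ext_iff]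
  exact ⟨fun h => h.ne, Finset.inter_subset_left.ssubset_of_ne⟩

/-- In a `T1` semitopological semilattice topology on `exp_n λ`, every upper set
`↑x` is open and closed. -/
theorem up_isOpen_and_isClosed
    {Λ : Type*} [DecidableEq Λ] [Infinite Λ] (n : ℕ) (hn : 0 < n)
    [TopologicalSpace (Expn Λ n)] [T1Space (Expn Λ n)]
    (hsep : ∀ a : Expn Λ n, Continuous (Expn.inter a)) :
    ∀ x : Expn Λ n, IsOpen (Expn.up x) ∧ IsClosed (Expn.up x) := by
  intro x
  constructor
  · have h : Expn.up x = Expn.inter x ⁻¹' {z | z.1 ⊂ x.1}ᶜ := by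
      ext y
      simp only [mem_preimage, mem_compl_iff, mem_ofPred_eq, Expn.inter_ssubset_iff, not_not]
    rw [h]
    exact (Expn.finite_setOf_ssubset x).isClosed.isOpen_compl.preimage (hsep x)
  · have h : Expn.up x = Expn.inter x ⁻¹' {x} := by
      ext y
      exact Expn.inter_eq_left_iff.symm
    rw [h]
    exact isClosed_singleton.preimage (hsep x)
end

section
/- Let n be a positive integer and λ an infinite cardinal, and let τ be a T1 topology on exp_n λ such that the operation (x, y) ↦ x ∩ y is separately continuous. Then the topological space (exp_n λ, τ) is functionally Hausdorff and quasiregular (and hence Hausdorff). -/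
open Set Filter Topology TopologicalSpace

/-- In a `T1` topology with continuous translations, every upper set `↑x` is clopen. -/
theorem Expn.isClopen_up {Λ : Type*} [DecidableEq Λ] {n : ℕ}
    [TopologicalSpace (Expn Λ n)] [T1Space (Expn Λ n)] (x : Expn Λ n)
    (hx : Continuous (Expn.inter x)) : IsClopen (Expn.up x) := by
  have hup : Expn.up x = Expn.inter x ⁻¹' {x} := by
    ext y
    simp [Expn.up, Expn.inter, Subtype.ext_iff]
  have hfin : {y : Expn Λ n | y.1 ⊆ x.1 ∧ y ≠ x}.Finite := by
    refine Set.Finite.subset (Set.Finite.preimage Subtype.val_injective.injOn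
      (x.1.powerset.finite_toSet)) ?_
    intro y hy
    simpa using hy.1
  refine ⟨hup ▸ isClosed_singleton.preimage hx, ?_⟩
  have hcompl : Expn.up x = (Expn.inter x ⁻¹' {y | y.1 ⊆ x.1 ∧ y ≠ x})ᶜ := by
    rw [hup]
    ext y
    have : (Expn.inter x y).1 ⊆ x.1 := Finset.inter_subset_left
    simp only [mem_preimage, mem_singleton_iff, mem_compl_iff, mem_ofPred_eq, this, true_and,
      not_not, ne_eq]
  rw [hcompl]
  exact (hfin.isClosed.preimage hx).isOpen_compl

/-- Distinct points are separated by a clopen set. -/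
theorem Expn.exists_isClopen_of_ne {Λ : Type*} [DecidableEq Λ] {n : ℕ}
    [TopologicalSpace (Expn Λ n)] [T1Space (Expn Λ n)]
    (hsep : ∀ a : Expn Λ n, Continuous (Expn.inter a)) {x y : Expn Λ n} (hxy : x ≠ y) :
    ∃ C : Set (Expn Λ n), IsClopen C ∧ x ∉ C ∧ y ∈ C := by
  by_cases h : y.1 ⊆ x.1
  · have h' : ¬ x.1 ⊆ y.1 := fun h' => hxy (Subtype.ext (h'.antisymm h))
    exact ⟨(Expn.up x)ᶜ, (Expn.isClopen_up x (hsep x)).compl,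
      fun hx => hx (Finset.Subset.refl _), h'⟩
  · exact ⟨Expn.up y, Expn.isClopen_up y (hsep y), h, Finset.Subset.refl _⟩

/-- Every nonempty open set contains an isolated point. -/
theorem Expn.exists_isOpen_singleton {Λ : Type*} [DecidableEq Λ] {n : ℕ}
    [TopologicalSpace (Expn Λ n)] [T1Space (Expn Λ n)]
    (hsep : ∀ a : Expn Λ n, Continuous (Expn.inter a)) {U : Set (Expn Λ n)}
    (hU : IsOpen U) (hne : U.Nonempty) : ∃ x ∈ U, IsOpen ({x} : Set (Expn Λ n)) := by
  have hbdd : BddAbove ((fun y : Expn Λ n => y.1.card) '' U) :=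
    ⟨n, by rintro _ ⟨y, -, rfl⟩; exact y.2⟩
  obtain ⟨x, hxU, hx⟩ := Nat.sSup_mem (hne.image _) hbdd
  refine ⟨x, hxU, ?_⟩
  have hsing : ({x} : Set (Expn Λ n)) = U ∩ Expn.up x := by
    ext y
    constructor
    · rintro rfl
      exact ⟨hxU, Finset.Subset.refl _⟩
    · rintro ⟨hyU, hxy⟩
      have hle : y.1.card ≤ x.1.card := (le_csSup hbdd ⟨y, hyU, rfl⟩).trans hx.ge
      exact Subtype.ext (Finset.eq_of_subset_of_card_le hxy hle).symm
  rw [hsing]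
  exact hU.inter (Expn.isClopen_up x (hsep x)).isOpen

/-- Every `T1` semitopological semilattice topology on `exp_n λ` is functionally
Hausdorff and quasiregular, and hence Hausdorff. -/
theorem functionallyHausdorff_quasiregular_t2
    {Λ : Type*} [DecidableEq Λ] [Infinite Λ] (n : ℕ) (hn : 0 < n)
    [TopologicalSpace (Expn Λ n)] [T1Space (Expn Λ n)]
    (hsep : ∀ a : Expn Λ n, Continuous (Expn.inter a)) :
    (∀ x y : Expn Λ n, x ≠ y →
        ∃ f : Expn Λ n → unitInterval, Continuous f ∧ f x = 0 ∧ f y = 1) ∧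
    (∀ U : Set (Expn Λ n), IsOpen U → U.Nonempty →
        ∃ V : Set (Expn Λ n), IsOpen V ∧ V.Nonempty ∧ V ⊆ U ∧ closure V ⊆ U) ∧
    T2Space (Expn Λ n) := by
  refine ⟨fun x y hxy => ?_, fun U hU hne => ?_, ⟨fun x y hxy => ?_⟩⟩
  · obtain ⟨C, hC, hxC, hyC⟩ := Expn.exists_isClopen_of_ne hsep hxy
    classical
    refine ⟨fun z => if z ∈ C then 1 else 0, ?_, by simp [hxC], by simp [hyC]⟩
    refine continuous_const.if (fun z hz => ?_) continuous_const
    exact absurd (hC.frontier_eq ▸ hz : z ∈ (∅ : Set (Expn Λ n))) (Set.notMem_empty z)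
  · obtain ⟨x, hxU, hx⟩ := Expn.exists_isOpen_singleton hsep hU hne
    refine ⟨{x}, hx, Set.singleton_nonempty x, by simpa using hxU, ?_⟩
    simpa [closure_singleton] using hxU
  · obtain ⟨C, hC, hxC, hyC⟩ := Expn.exists_isClopen_of_ne hsep hxy
    exact ⟨Cᶜ, C, hC.compl.isOpen, hC.isOpen, hxC, hyC, disjoint_compl_left⟩
end

section
/- Let n be a positive integer and λ an infinite cardinal, and let τ be a T1 topology on exp_n λ such that the operation (x, y) ↦ x ∩ y is separately continuous. Then the topological space (exp_n λ, τ) is scattered and hereditarily disconnected (totally disconnected). -/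
open Set Filter Topology TopologicalSpace

/-- Every `T1` semitopological semilattice topology on `exp_n λ` is scattered and
hereditarily disconnected (totally disconnected). -/
theorem scattered_and_totallyDisconnected
    {Λ : Type*} [DecidableEq Λ] [Infinite Λ] (n : ℕ) (hn : 0 < n)
    [TopologicalSpace (Expn Λ n)] [T1Space (Expn Λ n)]
    (hsep : ∀ a : Expn Λ n, Continuous (Expn.inter a)) :
    (∀ A : Set (Expn Λ n), A.Nonempty →
        ∃ x ∈ A, ∃ U : Set (Expn Λ n), IsOpen U ∧ U ∩ A = {x}) ∧
    TotallyDisconnectedSpace (Expn Λ n) := by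
  have hclopen (x : Expn Λ n) : IsClopen (Expn.up x) := Expn.isClopen_up x (hsep x)
  constructor
  · intro A hA
    have hbdd : BddAbove ((fun x : Expn Λ n => x.1.card) '' A) :=
      ⟨n, by rintro _ ⟨x, -, rfl⟩; exact x.2⟩
    obtain ⟨x, hxA, hx⟩ := Nat.sSup_mem (hA.image _) hbdd
    refine ⟨x, hxA, Expn.up x, (hclopen x).isOpen, ?_⟩
    ext y
    constructor
    · rintro ⟨hxy, hyA⟩
      have hcard : y.1.card ≤ x.1.card :=
        (le_csSup hbdd (Set.mem_image_of_mem _ hyA)).trans hx.ge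
      exact Subtype.ext (Finset.eq_of_subset_of_card_le hxy hcard).symm
    · rintro rfl
      exact ⟨Finset.Subset.refl _, hxA⟩
  · have : TotallySeparatedSpace (Expn Λ n) := by
      refine totallySeparatedSpace_iff_exists_isClopen.2 fun a b hab => ?_
      by_cases h : a.1 ⊆ b.1
      · refine ⟨(Expn.up b)ᶜ, (hclopen b).compl, fun hba => ?_, fun hb => hb ?_⟩
        · exact hab (Subtype.ext (h.antisymm hba))
        · exact Finset.Subset.refl _
      · exact ⟨Expn.up a, hclopen a, Finset.Subset.refl _, h⟩
    infer_instance
end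

section
/- Let n be a positive integer and λ an infinite cardinal. The topological space (exp_n λ, τ_c^n) is compact. -/
open Set Filter Topology TopologicalSpace

/-- The topology `τ_c^n` on `exp_n λ`, generated by the sets `↑x` and their complements. -/
def tauC (Λ : Type*) [DecidableEq Λ] (n : ℕ) : TopologicalSpace (Expn Λ n) :=
  TopologicalSpace.generateFrom
    ((Set.range fun x : Expn Λ n => Expn.up x) ∪ (Set.range fun x : Expn Λ n => (Expn.up x)ᶜ))

/-- An ultrafilter on `exp_n λ` contains `↑z` as soon as it contains `{y | a ∈ y}` for all `a ∈ z`. -/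
theorem Expn.up_mem_ultrafilter {Λ : Type*} [DecidableEq Λ] {n : ℕ} (F : Ultrafilter (Expn Λ n))
    (z : Finset Λ) (hz : ∀ a ∈ z, {y : Expn Λ n | a ∈ y.1} ∈ F) :
    {y : Expn Λ n | z ⊆ y.1} ∈ F := by
  have h : (⋂ a ∈ z, {y : Expn Λ n | a ∈ y.1}) ∈ (F : Filter (Expn Λ n)) :=
    (Filter.biInter_finset_mem z).2 hz
  exact Filter.mem_of_superset h fun y hy a ha => Set.mem_iInter₂.1 hy a ha

/-- The pointwise limit of an ultrafilter on `exp_n λ` is again an element of `exp_n λ`. -/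
theorem Expn.exists_ultrafilter_limit {Λ : Type*} [DecidableEq Λ] {n : ℕ}
    (F : Ultrafilter (Expn Λ n)) :
    ∃ x : Expn Λ n, ∀ a, a ∈ x.1 ↔ {y : Expn Λ n | a ∈ y.1} ∈ F := by
  have hcard (z : Finset Λ) (hz : ∀ a ∈ z, {y : Expn Λ n | a ∈ y.1} ∈ F) : z.card ≤ n := by
    obtain ⟨y, hy⟩ := F.nonempty_of_mem (Expn.up_mem_ultrafilter F z hz)
    exact (Finset.card_le_card hy).trans y.2
  have hfin : {a : Λ | {y : Expn Λ n | a ∈ y.1} ∈ F}.Finite := by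
    by_contra hinf
    obtain ⟨t, ht, htn⟩ := Set.Infinite.exists_subset_card_eq hinf (n + 1)
    have := hcard t fun a ha => ht ha
    omega
  exact ⟨⟨hfin.toFinset, hcard _ fun a ha => hfin.mem_toFinset.1 ha⟩,
    fun a => hfin.mem_toFinset⟩

/-- `(exp_n λ, τ_c^n)` is compact. -/
theorem tauC_compactSpace
    {Λ : Type*} [DecidableEq Λ] [Infinite Λ] (n : ℕ) (hn : 0 < n) :
    @CompactSpace (Expn Λ n) (tauC Λ n) := by
  let _ : TopologicalSpace (Expn Λ n) := tauC Λ n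
  refine ⟨isCompact_iff_ultrafilter_le_nhds.2 fun F _ => ?_⟩
  obtain ⟨x, hx⟩ := Expn.exists_ultrafilter_limit F
  refine ⟨x, Set.mem_univ x, ?_⟩
  refine le_of_le_of_eq ?_ TopologicalSpace.nhds_generateFrom.symm
  refine le_iInf₂ fun s hs => Filter.le_principal_iff.2 ?_
  obtain ⟨hxs, ⟨z, rfl⟩ | ⟨z, rfl⟩⟩ := hs
  · exact Expn.up_mem_ultrafilter F z.1 fun a ha => (hx a).1 (hxs ha)
  · obtain ⟨a, ha, hax⟩ := Finset.not_subset.1 hxs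
    refine Filter.mem_of_superset
      (Ultrafilter.compl_mem_iff_notMem.2 fun h => hax ((hx a).2 h)) fun y hy hzy => hy (hzy ha)
end

section
/- Let n be a positive integer and λ an infinite cardinal. The space (exp_n λ, τ_c^n) is zero-dimensional (has a base consisting of clopen sets), Hausdorff, and the semilattice operation (x, y) ↦ x ∩ y is jointly continuous with respect to τ_c^n. -/
open Set Filter Topology TopologicalSpace

theorem Expn.isClopen_up_s6 {Λ : Type*} [DecidableEq Λ] {n : ℕ} (x : Expn Λ n) :
    @IsClopen _ (tauC Λ n) x.up := by
  let := tauC Λ n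
  exact ⟨⟨isOpen_generateFrom_of_mem (Or.inr ⟨x, rfl⟩)⟩,
    isOpen_generateFrom_of_mem (Or.inl ⟨x, rfl⟩)⟩

theorem Expn.preimage_inter_up {Λ : Type*} [DecidableEq Λ] {n : ℕ} (x : Expn Λ n) :
    (fun p : Expn Λ n × Expn Λ n => Expn.inter p.1 p.2) ⁻¹' x.up = x.up ×ˢ x.up := by
  ext p
  exact Finset.subset_inter_iff

theorem Expn.isTopologicalBasis_isClopen (Λ : Type*) [DecidableEq Λ] (n : ℕ) :
    @IsTopologicalBasis _ (tauC Λ n) {U | @IsClopen _ (tauC Λ n) U} := by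
  let := tauC Λ n
  refine (isTopologicalBasis_of_subbasis (rfl : tauC Λ n = _)).of_isOpen_of_subset
    (fun U hU => hU.isOpen) ?_
  rintro _ ⟨f, ⟨hfin, hf⟩, rfl⟩
  change IsClopen (⋂₀ f)
  rw [sInter_eq_biInter]
  refine hfin.isClopen_biInter fun U hU => ?_
  rcases hf hU with ⟨x, rfl⟩ | ⟨x, rfl⟩
  exacts [x.isClopen_up_s6, x.isClopen_up_s6.compl]

theorem Expn.t2Space_tauC (Λ : Type*) [DecidableEq Λ] (n : ℕ) :
    @T2Space _ (tauC Λ n) := by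
  let := tauC Λ n
  refine ⟨fun a b hab => ?_⟩
  by_cases h : a.1 ⊆ b.1
  · have h' : ¬ b.1 ⊆ a.1 := fun h' => hab (Subtype.ext (h.antisymm h'))
    exact ⟨b.upᶜ, b.up, b.isClopen_up_s6.compl.isOpen, b.isClopen_up_s6.isOpen, h',
      Finset.Subset.refl _, disjoint_compl_left⟩
  · exact ⟨a.up, a.upᶜ, a.isClopen_up_s6.isOpen, a.isClopen_up_s6.compl.isOpen,
      Finset.Subset.refl _, h, disjoint_compl_right⟩

theorem Expn.continuous_inter (Λ : Type*) [DecidableEq Λ] (n : ℕ) :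
    @Continuous _ _ (@instTopologicalSpaceProd _ _ (tauC Λ n) (tauC Λ n)) (tauC Λ n)
      (fun p : Expn Λ n × Expn Λ n => Expn.inter p.1 p.2) := by
  let := tauC Λ n
  have h (x : Expn Λ n) :
      IsClopen ((fun p : Expn Λ n × Expn Λ n => Expn.inter p.1 p.2) ⁻¹' x.up) := by
    rw [x.preimage_inter_up]
    exact x.isClopen_up_s6.prod x.isClopen_up_s6
  refine continuous_generateFrom_iff.2 ?_
  rintro _ (⟨x, rfl⟩ | ⟨x, rfl⟩)
  exacts [(h x).isOpen, (h x).compl.isOpen]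

/-- `(exp_n λ, τ_c^n)` is zero-dimensional, Hausdorff, and the semilattice
operation is jointly continuous with respect to `τ_c^n`. -/
theorem tauC_zeroDim_t2_continuous_inter
    {Λ : Type*} [DecidableEq Λ] [Infinite Λ] (n : ℕ) (hn : 0 < n) :
    (∃ B : Set (Set (Expn Λ n)), (∀ U ∈ B, @IsClopen _ (tauC Λ n) U) ∧
        @TopologicalSpace.IsTopologicalBasis _ (tauC Λ n) B) ∧
    @T2Space _ (tauC Λ n) ∧
    @Continuous _ _ (@instTopologicalSpaceProd _ _ (tauC Λ n) (tauC Λ n)) (tauC Λ n)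
      (fun p : Expn Λ n × Expn Λ n => Expn.inter p.1 p.2) := by
  exact ⟨⟨_, fun _ hU => hU, Expn.isTopologicalBasis_isClopen Λ n⟩,
    Expn.t2Space_tauC Λ n, Expn.continuous_inter Λ n⟩
end

section
/- Let n be a positive integer and λ an infinite cardinal, and let τ be a T1 topology on exp_n λ. Then the following conditions are equivalent: (i) τ is compact and the operation (x, y) ↦ x ∩ y is jointly continuous; (ii) τ = τ_c^n; (iii) τ is countably compact and the operation is jointly continuous; (iv) τ is feebly compact and the operation is jointly continuous; (v) τ is compact and the operation is separately continuous; (vi) τ is countably compact and the operation is separately continuous. -/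
open Set Filter Topology TopologicalSpace

/-- A space is countably compact if every countable open cover has a finite subcover. -/
def CountablyCompactSp (X : Type*) [TopologicalSpace X] : Prop :=
  ∀ U : ℕ → Set X, (∀ i, IsOpen (U i)) → (⋃ i, U i) = Set.univ →
    ∃ t : Finset ℕ, (⋃ i ∈ t, U i) = Set.univ

/-- A space is feebly compact if every locally finite open cover is finite. -/
def FeeblyCompactSp (X : Type*) [TopologicalSpace X] : Prop :=
  ∀ 𝒰 : Set (Set X), (∀ U ∈ 𝒰, IsOpen U) → ⋃₀ 𝒰 = Set.univ →
    LocallyFinite (fun U : 𝒰 => (U : Set X)) → 𝒰.Finite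

namespace Expn

variable {Λ : Type*} [DecidableEq Λ] {n : ℕ}

/-- The basic neighbourhoods of `x` in `τ_c^n`: the `y ⊇ x` that meet `S` only inside `x`. -/
def basic (x : Expn Λ n) (S : Finset Λ) : Set (Expn Λ n) :=
  {y | x.1 ⊆ y.1 ∧ ∀ a ∈ S, a ∈ y.1 → a ∈ x.1}

theorem self_mem_basic (x : Expn Λ n) (S : Finset Λ) : x ∈ basic x S :=
  ⟨Finset.Subset.refl _, fun _ _ h => h⟩

theorem isClopen_up_tauC (x : Expn Λ n) : @IsClopen _ (tauC Λ n) (up x) := by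
  let _ := tauC Λ n
  exact ⟨⟨isOpen_generateFrom_of_mem (.inr ⟨x, rfl⟩)⟩, isOpen_generateFrom_of_mem (.inl ⟨x, rfl⟩)⟩

/-- If all maps `y ↦ a ∩ y` are continuous for a `T1` topology, then the upper sets are clopen. -/
theorem isClopen_up_s7 [TopologicalSpace (Expn Λ n)] [T1Space (Expn Λ n)]
    (h : ∀ a : Expn Λ n, Continuous (inter a)) (x : Expn Λ n) : IsClopen (up x) := by
  have hfin : {z : Expn Λ n | z.1 ⊆ x.1}.Finite :=
    ((x.1.powerset.finite_toSet).preimage Subtype.val_injective.injOn).subset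
      fun z hz => by simpa using hz
  have h1 : up x = inter x ⁻¹' {x} := by
    ext y
    simp [up, inter, Subtype.ext_iff]
  have h2 : (up x)ᶜ = inter x ⁻¹' ({z : Expn Λ n | z.1 ⊆ x.1} \ {x}) := by
    ext y
    simp [up, inter, Subtype.ext_iff, -Subtype.mk_le_mk, -Subtype.coe_le_coe]
  refine ⟨h1 ▸ isClosed_singleton.preimage (h x), ?_⟩
  rw [← isClosed_compl_iff, h2]
  exact (hfin.subset sdiff_subset).isClosed.preimage (h x)

theorem le_tauC [TopologicalSpace (Expn Λ n)] (h : ∀ x : Expn Λ n, IsClopen (up x)) :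
    (inferInstance : TopologicalSpace (Expn Λ n)) ≤ tauC Λ n := by
  refine le_generateFrom ?_
  rintro _ (⟨x, rfl⟩ | ⟨x, rfl⟩)
  · exact (h x).isOpen
  · exact (h x).compl.isOpen

theorem isClopen_mem [TopologicalSpace (Expn Λ n)] (hn : 0 < n)
    (h : ∀ x : Expn Λ n, IsClopen (up x)) (a : Λ) : IsClopen {y : Expn Λ n | a ∈ y.1} := by
  convert h ⟨{a}, (Finset.card_singleton a).trans_le hn⟩ using 1
  ext y
  simp [up]

theorem isOpen_basic [TopologicalSpace (Expn Λ n)] (hn : 0 < n)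
    (h : ∀ x : Expn Λ n, IsClopen (up x)) (x : Expn Λ n) (S : Finset Λ) :
    IsOpen (basic x S) := by
  have : basic x S = up x ∩ ⋂ a ∈ S \ x.1, {y : Expn Λ n | a ∈ y.1}ᶜ := by
    ext y
    simp only [basic, up, mem_ofPred_eq, mem_inter_iff, mem_iInter, Finset.mem_sdiff, mem_compl_iff]
    grind
  rw [this]
  exact (h x).isOpen.inter (isOpen_biInter_finset fun a _ => (isClopen_mem hn h a).compl.isOpen)

/-- A topology with clopen upper sets is `τ_c^n` as soon as its open sets contain basic sets. -/
theorem eq_tauC [τ : TopologicalSpace (Expn Λ n)] (hn : 0 < n)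
    (h : ∀ x : Expn Λ n, IsClopen (up x))
    (hb : ∀ U : Set (Expn Λ n), IsOpen U → ∀ x ∈ U, ∃ S, basic x S ⊆ U) : τ = tauC Λ n := by
  refine le_antisymm (le_tauC h) fun U hU => ?_
  let _ := tauC Λ n
  refine isOpen_iff_forall_mem_open.2 fun x hx => ?_
  obtain ⟨S, hS⟩ := hb U hU x hx
  exact ⟨_, hS, isOpen_basic hn isClopen_up_tauC x S, self_mem_basic x S⟩

/-- If `P` meets all basic neighbourhoods of `x`, it contains a sequence of sets above `x`
whose pairwise intersections are `x`. -/
theorem exists_seq (x : Expn Λ n) (P : Set (Expn Λ n)) (hP : ∀ S, (P ∩ basic x S).Nonempty) :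
    ∃ d : ℕ → Expn Λ n, (∀ k, d k ∈ P ∧ x.1 ⊆ (d k).1) ∧
      ∀ i j, i < j → (d i).1 ∩ (d j).1 ⊆ x.1 := by
  refine exists_seq_of_forall_finset_exists (fun y => y ∈ P ∧ x.1 ⊆ y.1)
    (fun y z => y.1 ∩ z.1 ⊆ x.1) fun s _ => ?_
  obtain ⟨y, hyP, hxy, hy⟩ := hP (s.biUnion Subtype.val)
  refine ⟨y, ⟨hyP, hxy⟩, fun z hz a ha => ?_⟩
  rw [Finset.mem_inter] at ha
  exact hy a (Finset.mem_biUnion.2 ⟨z, hz, ha.1⟩) ha.2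

/-- A sequence with pairwise intersections `x` accumulates at most at `x`. -/
theorem exists_isOpen_finite [TopologicalSpace (Expn Λ n)] (hn : 0 < n)
    (h : ∀ x : Expn Λ n, IsClopen (up x)) {x z : Expn Λ n} (hz : z ≠ x) {d : ℕ → Expn Λ n}
    (hd : ∀ k, x.1 ⊆ (d k).1) (hd' : ∀ i j, i < j → (d i).1 ∩ (d j).1 ⊆ x.1) :
    ∃ O : Set (Expn Λ n), IsOpen O ∧ z ∈ O ∧ {k | d k ∈ O}.Finite := by
  by_cases hxz : x.1 ⊆ z.1
  · obtain ⟨a, haz, hax⟩ : ∃ a ∈ z.1, a ∉ x.1 := by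
      by_contra! hc
      exact hz (Subtype.ext (Finset.Subset.antisymm hc hxz))
    refine ⟨_, (isClopen_mem hn h a).isOpen, haz, Set.Subsingleton.finite fun i hi j hj => ?_⟩
    by_contra hij
    rcases lt_or_gt_of_ne hij with hlt | hlt
    · exact hax (hd' i j hlt (Finset.mem_inter.2 ⟨hi, hj⟩))
    · exact hax (hd' j i hlt (Finset.mem_inter.2 ⟨hj, hi⟩))
  · refine ⟨(up x)ᶜ, (h x).compl.isOpen, hxz, ?_⟩
    convert Set.finite_empty
    ext k
    simpa [up] using hd k

/-- In a countably compact space every sequence accumulates somewhere. -/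
theorem _root_.CountablyCompactSp.exists_infinite {X : Type*} [TopologicalSpace X]
    (hX : CountablyCompactSp X) (d : ℕ → X) :
    ∃ z, ∀ O : Set X, IsOpen O → z ∈ O → {k | d k ∈ O}.Infinite := by
  by_contra! hc
  have hcov : (⋃ m, (closure (d '' Ici m))ᶜ) = univ := by
    refine eq_univ_of_forall fun z => mem_iUnion.2 ?_
    obtain ⟨O, hO, hzO, hfin⟩ := hc z
    obtain ⟨m, hm⟩ := hfin.bddAbove
    refine ⟨m + 1, fun hz => ?_⟩
    obtain ⟨_, hyO, k, hk, rfl⟩ := mem_closure_iff.1 hz O hO hzO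
    exact absurd (hm hyO) (by simpa using hk)
  obtain ⟨t, ht⟩ := hX _ (fun m => isClosed_closure.isOpen_compl) hcov
  have hmem : d (t.sup id) ∈ ⋃ i ∈ t, (closure (d '' Ici i))ᶜ := ht ▸ mem_univ _
  obtain ⟨i, hi, hn⟩ := mem_iUnion₂.1 hmem
  exact hn (subset_closure ⟨_, Finset.le_sup (f := id) hi, rfl⟩)

theorem eq_tauC_of_countablyCompactSp [τ : TopologicalSpace (Expn Λ n)] [T1Space (Expn Λ n)]
    (hn : 0 < n) (hX : CountablyCompactSp (Expn Λ n))
    (hc : ∀ a : Expn Λ n, Continuous (inter a)) : τ = tauC Λ n := by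
  have h := isClopen_up_s7 hc
  refine eq_tauC hn h fun U hU x hx => ?_
  by_contra! hS
  obtain ⟨d, hd, hd'⟩ := exists_seq x Uᶜ fun S => by
    obtain ⟨y, hy, hyU⟩ := not_subset.1 (hS S)
    exact ⟨y, hyU, hy⟩
  obtain ⟨z, hz⟩ := hX.exists_infinite d
  by_cases hzx : z = x
  · subst hzx
    obtain ⟨k, hk⟩ := (hz U hU hx).nonempty
    exact (hd k).1 hk
  · obtain ⟨O, hO, hzO, hfin⟩ := exists_isOpen_finite hn h hzx (fun k => (hd k).2) hd'
    exact hz O hO hzO hfin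

/-- Isolated points are dense: an inclusion-maximal member of an open set is isolated. -/
theorem exists_isOpen_singleton_s7 [TopologicalSpace (Expn Λ n)]
    (h : ∀ x : Expn Λ n, IsClopen (up x)) {W : Set (Expn Λ n)} (hW : IsOpen W)
    (hne : W.Nonempty) : ∃ y ∈ W, IsOpen {y} := by
  have hfin : ((fun y : Expn Λ n => y.1.card) '' W).Finite :=
    (finite_Iic n).subset (by rintro _ ⟨y, -, rfl⟩; exact y.2)
  obtain ⟨y, hyW, hy⟩ := hfin.exists_maximalFor' _ _ hne
  refine ⟨y, hyW, ?_⟩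
  convert hW.inter (h y).isOpen using 1
  ext z
  refine ⟨?_, fun hz => ?_⟩
  · rintro rfl
    exact ⟨hyW, Finset.Subset.refl _⟩
  · exact Subtype.ext (Finset.eq_of_subset_of_card_le hz.2 (le_of_not_gt fun hlt => hlt.not_ge (hy hz.1 hlt.le))).symm

/-- If intersection is jointly continuous, every open set contains the closure of a smaller
neighbourhood. -/
theorem exists_closure_subset [TopologicalSpace (Expn Λ n)] (hn : 0 < n)
    (h : ∀ x : Expn Λ n, IsClopen (up x))
    (hc : Continuous fun p : Expn Λ n × Expn Λ n => inter p.1 p.2)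
    {U : Set (Expn Λ n)} (hU : IsOpen U) {x : Expn Λ n} (hx : x ∈ U) :
    ∃ V : Set (Expn Λ n), IsOpen V ∧ x ∈ V ∧ closure V ⊆ U := by
  have hself : inter x x = x := Subtype.ext (Finset.inter_self _)
  obtain ⟨A, B, hA, hB, hxA, hxB, hAB⟩ := isOpen_prod_iff.1 (hU.preimage hc) x x
    (by simpa [hself] using hx)
  refine ⟨A ∩ B, hA.inter hB, ⟨hxA, hxB⟩, fun y hy => ?_⟩
  obtain ⟨v, hv, hvV⟩ := mem_closure_iff.1 hy _ (h y).isOpen (Finset.Subset.refl _)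
  obtain ⟨w, hw, hwV⟩ := mem_closure_iff.1 hy _ (isOpen_basic hn h y v.1) (self_mem_basic _ _)
  have hvw : inter v w = y := by
    refine Subtype.ext (Finset.Subset.antisymm (fun a ha => ?_) (Finset.subset_inter hv hw.1))
    exact hw.2 a (Finset.mem_inter.1 ha).1 (Finset.mem_inter.1 ha).2
  have : (v, w) ∈ A ×ˢ B := ⟨hvV.1, hwV.2⟩
  simpa [hvw] using hAB this

/-- A feebly compact space has no injective sequence of isolated points without accumulation. -/
theorem _root_.FeeblyCompactSp.exists_infinite {X : Type*} [TopologicalSpace X]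
    (hX : FeeblyCompactSp X) {d : ℕ → X} (hinj : Function.Injective d)
    (hd : ∀ k, IsOpen {d k}) :
    ∃ z, ∀ O : Set X, IsOpen O → z ∈ O → {k | d k ∈ O}.Infinite := by
  by_contra! hc
  have hfin : (insert univ (range fun k => ({d k} : Set X))).Finite := by
    refine hX _ ?_ (by simp) fun z => ?_
    · rintro _ (rfl | ⟨k, rfl⟩)
      exacts [isOpen_univ, hd k]
    · obtain ⟨O, hO, hzO, hf⟩ := hc z
      refine ⟨O, hO.mem_nhds hzO, Set.Finite.of_finite_image (f := Subtype.val) ?_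
        Subtype.val_injective.injOn⟩
      refine ((hf.image fun k => ({d k} : Set X)).insert univ).subset ?_
      rintro _ ⟨⟨_, rfl | ⟨k, rfl⟩⟩, hk, rfl⟩
      · exact mem_insert _ _
      · exact mem_insert_of_mem _ ⟨k, (singleton_inter_nonempty (s := O)).1 hk, rfl⟩
  exact infinite_range_of_injective (singleton_injective.comp hinj)
    (hfin.subset (subset_insert _ _))

theorem eq_tauC_of_feeblyCompactSp [τ : TopologicalSpace (Expn Λ n)] [T1Space (Expn Λ n)]
    (hn : 0 < n) (hX : FeeblyCompactSp (Expn Λ n))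
    (hc : Continuous fun p : Expn Λ n × Expn Λ n => inter p.1 p.2) : τ = tauC Λ n := by
  have h := isClopen_up_s7 fun a : Expn Λ n => hc.comp (Continuous.prodMk_right a)
  refine eq_tauC hn h fun U hU x hx => ?_
  by_contra! hS
  obtain ⟨V, hV, hxV, hVU⟩ := exists_closure_subset hn h hc hU hx
  obtain ⟨d, hd, hd'⟩ := exists_seq x ({y | IsOpen {y}} ∩ (closure V)ᶜ) fun S => by
    obtain ⟨y, hy, hyU⟩ := not_subset.1 (hS S)
    obtain ⟨w, hw, hwo⟩ := exists_isOpen_singleton_s7 h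
      (isClosed_closure.isOpen_compl.inter (isOpen_basic hn h x S)) ⟨y, fun hyV => hyU (hVU hyV), hy⟩
    exact ⟨w, ⟨hwo, hw.1⟩, hw.2⟩
  have hinj : Function.Injective d := by
    refine Function.Injective.of_lt_imp_ne fun i j hij heq => (hd j).1.2 (subset_closure ?_)
    have hdx : (d j).1 ⊆ x.1 := by simpa [heq] using hd' i j hij
    rwa [Subtype.ext (Finset.Subset.antisymm hdx (hd j).2)]
  obtain ⟨z, hz⟩ := hX.exists_infinite hinj fun k => (hd k).1.1
  by_cases hzx : z = x
  · subst hzx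
    obtain ⟨k, hk⟩ := (hz V hV hxV).nonempty
    exact (hd k).1.2 (subset_closure hk)
  · obtain ⟨O, hO, hzO, hfin⟩ := exists_isOpen_finite hn h hzx (fun k => (hd k).2) hd'
    exact hz O hO hzO hfin

theorem continuous_inter_tauC :
    @Continuous _ _ (@instTopologicalSpaceProd _ _ (tauC Λ n) (tauC Λ n)) (tauC Λ n)
      (fun p : Expn Λ n × Expn Λ n => inter p.1 p.2) := by
  let _ := tauC Λ n
  have key (x : Expn Λ n) :
      IsClopen ((fun p : Expn Λ n × Expn Λ n => inter p.1 p.2) ⁻¹' up x) := by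
    convert (isClopen_up_tauC x).prod (isClopen_up_tauC x) using 1
    ext p
    exact Finset.subset_inter_iff
  refine continuous_generateFrom_iff.2 ?_
  rintro _ (⟨x, rfl⟩ | ⟨x, rfl⟩)
  · exact (key x).isOpen
  · exact (key x).compl.isOpen

theorem compactSpace_tauC : @CompactSpace _ (tauC Λ n) := by
  let f : Expn Λ n → Λ → Bool := fun x a => decide (a ∈ x.1)
  have hclosed : IsClosed (range f) := by
    rw [← isOpen_compl_iff, isOpen_iff_forall_mem_open]
    intro g hg
    obtain ⟨s, hs, hsn⟩ : ∃ s : Finset Λ, (∀ a ∈ s, g a = true) ∧ n < s.card := by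
      by_contra! hcard
      have hfin : {a | g a = true}.Finite := by
        by_contra hinf
        obtain ⟨s, hs, hsn⟩ := Set.Infinite.exists_subset_card_eq hinf (n + 1)
        have := hcard s fun a ha => hs ha
        omega
      refine hg ⟨⟨hfin.toFinset, hcard _ fun a ha => by simpa using ha⟩, ?_⟩
      ext a
      simp [f]
    refine ⟨⋂ a ∈ s, (fun g : Λ → Bool => g a) ⁻¹' {true}, ?_, ?_, by simpa using hs⟩
    · rintro g' hg' ⟨x, rfl⟩
      have hsx : s ⊆ x.1 := fun a ha => by simpa [f] using mem_iInter₂.1 hg' a ha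
      exact absurd (Finset.card_le_card hsx) (by have := x.2; omega)
    · exact isOpen_biInter_finset fun a _ => (isOpen_discrete _).preimage (continuous_apply a)
  let _ : TopologicalSpace (Expn Λ n) := induced f inferInstance
  have hcompact : CompactSpace (Expn Λ n) :=
    ⟨(Topology.IsInducing.mk rfl).isCompact_iff.2 (image_univ ▸ hclosed.isCompact)⟩
  have hup (x : Expn Λ n) : IsClopen (up x) := by
    have : up x = f ⁻¹' ⋂ a ∈ x.1, (fun g : Λ → Bool => g a) ⁻¹' {true} := by
      ext y
      simp [up, f, -Subtype.coe_le_coe, Finset.subset_iff]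
    rw [this]
    exact (isClopen_biInter_finset fun a _ => (isClopen_discrete _).preimage
      (continuous_apply a)).preimage continuous_induced_dom
  exact @CompactSpace.mk _ (tauC Λ n) (image_id univ ▸
    @IsCompact.image _ _ _ (tauC Λ n) _ id isCompact_univ (continuous_id_of_le (le_tauC hup)))

end Expn

theorem CompactSpace.countablyCompactSp {X : Type*} [TopologicalSpace X] [CompactSpace X] :
    CountablyCompactSp X := fun U hU hcov => by
  obtain ⟨t, ht⟩ := isCompact_univ.elim_finite_subcover U hU hcov.ge
  exact ⟨t, univ_subset_iff.1 ht⟩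

theorem CompactSpace.feeblyCompactSp {X : Type*} [TopologicalSpace X] [CompactSpace X] :
    FeeblyCompactSp X := fun 𝒰 _ _ hlf => by
  refine ((hlf.finite_nonempty_of_compact.image Subtype.val).insert ∅).subset fun U hU => ?_
  rcases U.eq_empty_or_nonempty with rfl | hne
  · exact mem_insert _ _
  · exact mem_insert_of_mem _ ⟨⟨U, hU⟩, hne, rfl⟩

/-- For any `T1` topology `τ` on `exp_n λ` the following are equivalent:
(i) `τ` is compact and `∩` is jointly continuous; (ii) `τ = τ_c^n`; (iii) `τ` is countably
compact and `∩` is jointly continuous; (iv) `τ` is feebly compact and `∩` is jointly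
continuous; (v) `τ` is compact and `∩` is separately continuous; (vi) `τ` is countably
compact and `∩` is separately continuous. -/
theorem tfae_compact_topologies_on_expn
    {Λ : Type*} [DecidableEq Λ] [Infinite Λ] (n : ℕ) (hn : 0 < n)
    (τ : TopologicalSpace (Expn Λ n)) (hT1 : @T1Space _ τ) :
    List.TFAE
      [ @CompactSpace _ τ ∧
          @Continuous _ _ (@instTopologicalSpaceProd _ _ τ τ) τ
            (fun p : Expn Λ n × Expn Λ n => Expn.inter p.1 p.2),
        τ = tauC Λ n,
        @CountablyCompactSp _ τ ∧
          @Continuous _ _ (@instTopologicalSpaceProd _ _ τ τ) τ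
            (fun p : Expn Λ n × Expn Λ n => Expn.inter p.1 p.2),
        @FeeblyCompactSp _ τ ∧
          @Continuous _ _ (@instTopologicalSpaceProd _ _ τ τ) τ
            (fun p : Expn Λ n × Expn Λ n => Expn.inter p.1 p.2),
        @CompactSpace _ τ ∧ (∀ a : Expn Λ n, Continuous[τ, τ] (Expn.inter a)),
        @CountablyCompactSp _ τ ∧ (∀ a : Expn Λ n, Continuous[τ, τ] (Expn.inter a)) ] := by
  have sep (hc : @Continuous _ _ (@instTopologicalSpaceProd _ _ τ τ) τ
      (fun p : Expn Λ n × Expn Λ n => Expn.inter p.1 p.2)) (a : Expn Λ n) :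
      Continuous[τ, τ] (Expn.inter a) := hc.comp (Continuous.prodMk_right a)
  tfae_have 2 → 1 := by
    rintro rfl
    exact ⟨Expn.compactSpace_tauC, Expn.continuous_inter_tauC⟩
  tfae_have 1 → 5 := fun ⟨h, hc⟩ => ⟨h, sep hc⟩
  tfae_have 5 → 6 := fun ⟨_, hc⟩ => ⟨CompactSpace.countablyCompactSp, hc⟩
  tfae_have 6 → 2 := fun ⟨h, hc⟩ => Expn.eq_tauC_of_countablyCompactSp hn h hc
  tfae_have 1 → 3 := fun ⟨_, hc⟩ => ⟨CompactSpace.countablyCompactSp, hc⟩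
  tfae_have 3 → 6 := fun ⟨h, hc⟩ => ⟨h, sep hc⟩
  tfae_have 1 → 4 := fun ⟨_, hc⟩ => ⟨CompactSpace.feeblyCompactSp, hc⟩
  tfae_have 4 → 2 := fun ⟨h, hc⟩ => Expn.eq_tauC_of_feeblyCompactSp hn h hc
  tfae_finish
end

section
/- Let n be a positive integer and λ an infinite cardinal. Every countably compact T1 topology τ on exp_n λ for which the operation (x, y) ↦ x ∩ y is separately continuous is compact. -/
open Set Filter Topology TopologicalSpace

/-- Upper sets of a `T1` semitopological `exp_n λ` are closed. -/
theorem Expn.isClosed_up {Λ : Type*} [DecidableEq Λ] {n : ℕ}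
    [TopologicalSpace (Expn Λ n)] [T1Space (Expn Λ n)]
    (hsep : ∀ a : Expn Λ n, Continuous (Expn.inter a)) (x : Expn Λ n) :
    IsClosed (Expn.up x) := by
  have h : Expn.up x = Expn.inter x ⁻¹' {x} := by
    ext y
    simp [Expn.up, Expn.inter, Subtype.ext_iff, Finset.inter_eq_left]
  rw [h]
  exact isClosed_singleton.preimage (hsep x)

/-- Upper sets of a `T1` semitopological `exp_n λ` are open, because the principal ideal below
`x` is finite, hence discrete. -/
theorem Expn.isOpen_up {Λ : Type*} [DecidableEq Λ] {n : ℕ}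
    [TopologicalSpace (Expn Λ n)] [T1Space (Expn Λ n)]
    (hsep : ∀ a : Expn Λ n, Continuous (Expn.inter a)) (x : Expn Λ n) :
    IsOpen (Expn.up x) := by
  have hfin : {z : Expn Λ n | z.1 ⊆ x.1 ∧ z ≠ x}.Finite := by
    refine Set.Finite.of_finite_image (f := Subtype.val) ?_ Subtype.val_injective.injOn
    refine x.1.powerset.finite_toSet.subset ?_
    rintro _ ⟨z, hz, rfl⟩
    simpa using hz.1
  have h : (Expn.up x)ᶜ = Expn.inter x ⁻¹' {z | z.1 ⊆ x.1 ∧ z ≠ x} := by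
    ext y
    simp only [Expn.up, Expn.inter, Set.mem_compl_iff, Set.mem_ofPred_eq, Set.mem_preimage,
      ne_eq, Subtype.ext_iff, Finset.inter_eq_left, Finset.inter_subset_left, true_and]
  rw [← isClosed_compl_iff, h]
  exact hfin.isClosed.preimage (hsep x)

/-- In a countably compact space every sequence has a cluster point. -/
theorem CountablyCompactSp.exists_mem_closure_tails {X : Type*} [TopologicalSpace X]
    (hcc : CountablyCompactSp X) (f : ℕ → X) :
    ∃ b, ∀ m, b ∈ closure (f '' Set.Ici m) := by
  by_contra! hcon
  obtain ⟨t, ht⟩ := hcc (fun m => (closure (f '' Set.Ici m))ᶜ)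
    (fun m => isClosed_closure.isOpen_compl)
    (Set.eq_univ_of_forall fun b => Set.mem_iUnion.2 (hcon b))
  have hmem : f (t.sup id) ∈ ⋃ i ∈ t, (closure (f '' Set.Ici i))ᶜ := ht ▸ Set.mem_univ _
  simp only [Set.mem_iUnion] at hmem
  obtain ⟨i, hi, hfi⟩ := hmem
  exact hfi (subset_closure ⟨_, Finset.le_sup (f := id) hi, rfl⟩)

/-- A closed subset of a countably compact `T1` semitopological `exp_n λ` that contains a
sequence of supersets of `a` meeting pairwise inside `a` contains `a`. -/
theorem Expn.mem_of_sunflower {Λ : Type*} [DecidableEq Λ] {n : ℕ} (hn : 0 < n)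
    [TopologicalSpace (Expn Λ n)] [T1Space (Expn Λ n)]
    (hcc : CountablyCompactSp (Expn Λ n))
    (hsep : ∀ a : Expn Λ n, Continuous (Expn.inter a))
    {F : Set (Expn Λ n)} (hF : IsClosed F) {a : Expn Λ n} {f : ℕ → Expn Λ n}
    (hfF : ∀ k, f k ∈ F ∧ a.1 ⊆ (f k).1)
    (hf : ∀ k l, k < l → (f k).1 ∩ (f l).1 ⊆ a.1) : a ∈ F := by
  obtain ⟨b, hb⟩ := hcc.exists_mem_closure_tails f
  have hbF : b ∈ F ∩ Expn.up a :=
    closure_minimal (by rintro _ ⟨k, -, rfl⟩; exact hfF k)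
      (hF.inter (Expn.isClosed_up hsep a)) (hb 0)
  suffices hba : b.1 ⊆ a.1 by
    rw [Subtype.ext (hbF.2.antisymm hba)]
    exact hbF.1
  intro i hi
  have hmeet : ∀ m, ∃ k ≥ m, i ∈ (f k).1 := by
    intro m
    obtain ⟨_, hik, k, hk, rfl⟩ := mem_closure_iff.1 (hb m) _
      (Expn.isOpen_up hsep ⟨{i}, hn⟩)
      (show {i} ⊆ b.1 by simpa using hi)
    exact ⟨k, hk, Finset.singleton_subset_iff.1 hik⟩
  obtain ⟨k, -, hk⟩ := hmeet 0
  obtain ⟨l, hkl, hl⟩ := hmeet (k + 1)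
  exact hf k l hkl (Finset.mem_inter.2 ⟨hk, hl⟩)

/-- The points that belong to almost every set of an ultrafilter on `exp_n λ` form an element of
`exp_n λ`. -/
theorem Expn.exists_mem_iff_eventually_mem {Λ : Type*} [DecidableEq Λ] {n : ℕ}
    (u : Ultrafilter (Expn Λ n)) :
    ∃ a : Expn Λ n, ∀ i, i ∈ a.1 ↔ ∀ᶠ y in (u : Filter (Expn Λ n)), i ∈ y.1 := by
  set A : Set Λ := {i | ∀ᶠ y in (u : Filter (Expn Λ n)), i ∈ y.1}
  have hcard : ∀ t : Finset Λ, (t : Set Λ) ⊆ A → t.card ≤ n := by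
    intro t ht
    have hev : ∀ᶠ y in (u : Filter (Expn Λ n)), ∀ i ∈ t, i ∈ y.1 :=
      (Finset.eventually_all t).2 fun i hi => ht hi
    obtain ⟨y, hy⟩ := hev.exists
    exact (Finset.card_le_card hy).trans y.2
  have hA : A.Finite := by
    by_contra hinf
    obtain ⟨t, htA, ht⟩ := Set.Infinite.exists_subset_card_eq hinf (n + 1)
    have := hcard t htA
    omega
  exact ⟨⟨hA.toFinset, hcard _ (by simp)⟩, fun i => hA.mem_toFinset⟩

/-- Every countably compact `T1` semitopological semilattice topology on
`exp_n λ` is compact. -/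
theorem countablyCompact_semitopological_is_compact
    {Λ : Type*} [DecidableEq Λ] [Infinite Λ] (n : ℕ) (hn : 0 < n)
    [TopologicalSpace (Expn Λ n)] [T1Space (Expn Λ n)]
    (hcc : CountablyCompactSp (Expn Λ n))
    (hsep : ∀ a : Expn Λ n, Continuous (Expn.inter a)) :
    CompactSpace (Expn Λ n) := by
  refine ⟨isCompact_iff_ultrafilter_le_nhds.2 fun u _ => ?_⟩
  obtain ⟨a, ha⟩ := Expn.exists_mem_iff_eventually_mem u
  refine ⟨a, Set.mem_univ a, (nhds_basis_opens a).ge_iff.2 ?_⟩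
  rintro U ⟨haU, hU⟩
  by_contra hUu
  have hFu : ∀ᶠ y in (u : Filter (Expn Λ n)), y ∈ Uᶜ := Ultrafilter.compl_mem_iff_notMem.2 hUu
  have hau : ∀ᶠ y in (u : Filter (Expn Λ n)), a.1 ⊆ y.1 :=
    (Finset.eventually_all a.1).2 fun i hi => (ha i).1 hi
  obtain ⟨f, hfF, hf⟩ := exists_seq_of_forall_finset_exists
    (fun y : Expn Λ n => y ∈ Uᶜ ∧ a.1 ⊆ y.1) (fun x y => x.1 ∩ y.1 ⊆ a.1) (by
      intro s _
      have hs : ∀ᶠ y in (u : Filter (Expn Λ n)), ∀ x ∈ s, ∀ i ∈ x.1, i ∈ y.1 → i ∈ a.1 := by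
        refine (Finset.eventually_all s).2 fun x _ => (Finset.eventually_all x.1).2 fun i _ => ?_
        by_cases hi : i ∈ a.1
        · exact Eventually.of_forall fun _ _ => hi
        · have hnot := Ultrafilter.eventually_not.2 (mt (ha i).2 hi)
          exact hnot.mono fun y hy hiy => absurd hiy hy
      obtain ⟨y, ⟨hyF, hya⟩, hy⟩ := ((hFu.and hau).and hs).exists
      exact ⟨y, ⟨hyF, hya⟩, fun x hx i hi =>
        hy x hx i (Finset.mem_inter.1 hi).1 (Finset.mem_inter.1 hi).2⟩)
  exact Expn.mem_of_sunflower hn hcc hsep hU.isClosed_compl hfF hf haU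
end

section
/- Let λ be an infinite cardinal. Every feebly compact T1 topology τ on exp_1 λ such that the operation (x, y) ↦ x ∩ y is separately continuous is compact, and hence the operation (x, y) ↦ x ∩ y is jointly continuous with respect to τ. -/
open Set Filter Topology TopologicalSpace

namespace Expn

variable {Λ : Type*} [DecidableEq Λ]

/-- The least element of `exp_n λ`. -/
def empty (Λ : Type*) [DecidableEq Λ] (n : ℕ) : Expn Λ n := ⟨∅, by simp⟩

theorem inter_comm {n : ℕ} (a b : Expn Λ n) : inter a b = inter b a :=
  Subtype.ext (Finset.inter_comm _ _)

theorem empty_inter {n : ℕ} (a : Expn Λ n) : inter (empty Λ n) a = empty Λ n :=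
  Subtype.ext (Finset.empty_inter _)

theorem inter_ne_empty_iff {a b : Expn Λ 1} (ha : a ≠ empty Λ 1) :
    inter a b ≠ empty Λ 1 ↔ b = a := by
  constructor
  · intro h
    have h' : (a.1 ∩ b.1).Nonempty :=
      Finset.nonempty_iff_ne_empty.2 fun h' => h (Subtype.ext h')
    obtain ⟨x, hx⟩ := h'
    rw [Finset.mem_inter] at hx
    refine Subtype.ext (Finset.ext fun y => ⟨fun hy => ?_, fun hy => ?_⟩)
    · rw [Finset.card_le_one.1 b.2 y hy x hx.2]
      exact hx.1
    · rw [Finset.card_le_one.1 a.2 y hy x hx.1]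
      exact hx.2
  · rintro rfl
    rwa [show inter b b = b from Subtype.ext (Finset.inter_self _)]

theorem inter_eq_empty_or_left (a b : Expn Λ 1) :
    inter a b = empty Λ 1 ∨ inter a b = a := by
  by_cases ha : a = empty Λ 1
  · exact Or.inl (ha ▸ empty_inter b)
  · by_cases h : inter a b = empty Λ 1
    · exact Or.inl h
    · obtain rfl := (inter_ne_empty_iff ha).1 h
      exact Or.inr (Subtype.ext (Finset.inter_self _))

theorem isOpen_singleton_of_ne_empty [TopologicalSpace (Expn Λ 1)] [T1Space (Expn Λ 1)]
    (hsep : ∀ a : Expn Λ 1, Continuous (inter a)) {a : Expn Λ 1} (ha : a ≠ empty Λ 1) :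
    IsOpen ({a} : Set (Expn Λ 1)) := by
  have h := (isOpen_compl_singleton (x := empty Λ 1)).preimage (hsep a)
  convert h using 1
  ext b
  exact (inter_ne_empty_iff ha).symm

theorem continuous_inter_s10 [TopologicalSpace (Expn Λ 1)] [T1Space (Expn Λ 1)]
    (hsep : ∀ a : Expn Λ 1, Continuous (inter a)) :
    Continuous fun p : Expn Λ 1 × Expn Λ 1 => inter p.1 p.2 := by
  refine continuous_iff_continuousAt.2 fun ⟨a, b⟩ => ?_
  by_cases ha : a = empty Λ 1
  · by_cases hb : b = empty Λ 1
    · subst ha hb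
      intro W hW
      change W ∈ 𝓝 (inter (empty Λ 1) (empty Λ 1)) at hW
      rw [empty_inter] at hW
      have hfst : ∀ᶠ p : Expn Λ 1 × Expn Λ 1 in 𝓝 (empty Λ 1, empty Λ 1), p.1 ∈ W :=
        continuousAt_fst hW
      refine mem_map.2 ?_
      filter_upwards [hfst] with p hp
      rcases inter_eq_empty_or_left p.1 p.2 with h | h
      · exact (congrArg (· ∈ W) h).mpr (mem_of_mem_nhds hW)
      · exact (congrArg (· ∈ W) h).mpr hp
    · have hsnd : ∀ᶠ p : Expn Λ 1 × Expn Λ 1 in 𝓝 (a, b), p.2 ∈ ({b} : Set (Expn Λ 1)) :=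
        continuousAt_snd ((isOpen_singleton_of_ne_empty hsep hb).mem_nhds rfl)
      refine ((hsep b).comp continuous_fst).continuousAt.congr ?_
      filter_upwards [hsnd] with p hp
      rw [Function.comp_apply, inter_comm, mem_singleton_iff.1 hp]
  · have hfst : ∀ᶠ p : Expn Λ 1 × Expn Λ 1 in 𝓝 (a, b), p.1 ∈ ({a} : Set (Expn Λ 1)) :=
      continuousAt_fst ((isOpen_singleton_of_ne_empty hsep ha).mem_nhds rfl)
    refine ((hsep a).comp continuous_snd).continuousAt.congr ?_
    filter_upwards [hfst] with p hp
    rw [Function.comp_apply, mem_singleton_iff.1 hp]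

end Expn

/-- In a feebly compact space with at most one non-isolated point, every open neighbourhood of
that point is cofinite. -/
theorem FeeblyCompactSp.finite_compl {X : Type*} [TopologicalSpace X] (hfc : FeeblyCompactSp X)
    {x₀ : X} (hiso : ∀ x, x ≠ x₀ → IsOpen ({x} : Set X)) {U : Set X} (hU : IsOpen U)
    (hx₀ : x₀ ∈ U) : Uᶜ.Finite := by
  have hne : ∀ {x}, x ∉ U → x ≠ x₀ := fun hx h => hx (h ▸ hx₀)
  have hfin : (insert U ((fun x : X => ({x} : Set X)) '' Uᶜ)).Finite := by
    refine hfc _ ?_ ?_ ?_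
    · rintro V (rfl | ⟨x, hx, rfl⟩)
      · exact hU
      · exact hiso x (hne hx)
    · refine eq_univ_of_forall fun x => ?_
      by_cases hx : x ∈ U
      · exact ⟨U, Or.inl rfl, hx⟩
      · exact ⟨{x}, Or.inr ⟨x, hx, rfl⟩, rfl⟩
    · intro x
      by_cases hx : x ∈ U
      · refine ⟨U, hU.mem_nhds hx, Set.Finite.subset (Set.finite_singleton ⟨U, Or.inl rfl⟩) ?_⟩
        rintro ⟨V, rfl | ⟨y, hy, rfl⟩⟩ ⟨z, hz, hzU⟩
        · rfl
        · exact absurd ((mem_singleton_iff.1 hz) ▸ hzU) hy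
      · refine ⟨{x}, (hiso x (hne hx)).mem_nhds rfl,
          Set.Finite.subset (Set.finite_singleton ⟨{x}, Or.inr ⟨x, hx, rfl⟩⟩) ?_⟩
        rintro ⟨V, rfl | ⟨y, hy, rfl⟩⟩ ⟨z, hz, hzx⟩
        · exact absurd ((mem_singleton_iff.1 hzx) ▸ hz) hx
        · refine Subtype.ext ?_
          change ({y} : Set X) = {x}
          rw [← mem_singleton_iff.1 hz, mem_singleton_iff.1 hzx]
  exact (hfin.subset (subset_insert _ _)).of_finite_image singleton_injective.injOn

/-- A feebly compact space with at most one non-isolated point is compact. -/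
theorem FeeblyCompactSp.compactSpace {X : Type*} [TopologicalSpace X] (hfc : FeeblyCompactSp X)
    {x₀ : X} (hiso : ∀ x, x ≠ x₀ → IsOpen ({x} : Set X)) : CompactSpace X := by
  refine ⟨isCompact_of_finite_subcover fun {ι} U hU hcov => ?_⟩
  obtain ⟨i, hi⟩ := mem_iUnion.1 (hcov (mem_univ x₀))
  obtain ⟨t, ht⟩ := (hfc.finite_compl hiso (hU i) hi).isCompact.elim_finite_subcover U hU
    ((subset_univ _).trans hcov)
  classical
  refine ⟨insert i t, fun x _ => ?_⟩
  rw [Finset.set_biUnion_insert]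
  by_cases hx : x ∈ U i
  · exact Or.inl hx
  · exact Or.inr (ht hx)

/-- Every feebly compact `T1` semitopological semilattice topology on `exp_1 λ`
is compact, and hence the operation `∩` is jointly continuous. -/
theorem feeblyCompact_semitopological_exp1_is_compact
    {Λ : Type*} [DecidableEq Λ] [Infinite Λ]
    [TopologicalSpace (Expn Λ 1)] [T1Space (Expn Λ 1)]
    (hfc : FeeblyCompactSp (Expn Λ 1))
    (hsep : ∀ a : Expn Λ 1, Continuous (Expn.inter a)) :
    CompactSpace (Expn Λ 1) ∧
      Continuous fun p : Expn Λ 1 × Expn Λ 1 => Expn.inter p.1 p.2 := by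
  have hiso : ∀ a : Expn Λ 1, a ≠ Expn.empty Λ 1 → IsOpen ({a} : Set (Expn Λ 1)) :=
    fun _ => Expn.isOpen_singleton_of_ne_empty hsep
  exact ⟨hfc.compactSpace hiso, Expn.continuous_inter_s10 hsep⟩
end

section
/- Let λ be an infinite cardinal. There exists a Hausdorff topology τ on exp_2 λ such that the operation (x, y) ↦ x ∩ y is separately continuous but not jointly continuous, and the space (exp_2 λ, τ) is countably pracompact, H-closed, quasiregular, and not semiregular. -/
open Set Filter Topology TopologicalSpace

/-- A space is countably pracompact if it has a dense subset `A` such that every infinite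
subset of `A` has an accumulation point in the space. -/
def CountablyPracompactSp (X : Type*) [TopologicalSpace X] : Prop :=
  ∃ A : Set X, Dense A ∧ ∀ B ⊆ A, B.Infinite → ∃ x : X, AccPt x (Filter.principal B)

universe u v

/-- A Hausdorff space is H-closed if its image under any embedding into a Hausdorff space
is closed. -/
def HClosedSp (X : Type u) [TopologicalSpace X] : Prop :=
  ∀ (Y : Type v) (_ : TopologicalSpace Y), T2Space Y → ∀ f : X → Y,
    IsEmbedding f → IsClosed (Set.range f)

/-- A space is quasiregular if every nonempty open set contains a nonempty open set
together with its closure. -/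
def QuasiregularSp (X : Type*) [TopologicalSpace X] : Prop :=
  ∀ U : Set X, IsOpen U → U.Nonempty →
    ∃ V : Set X, IsOpen V ∧ V.Nonempty ∧ V ⊆ U ∧ closure V ⊆ U

/-- A space is semiregular if it has a base consisting of regular open sets. -/
def SemiregularSp (X : Type*) [TopologicalSpace X] : Prop :=
  ∃ B : Set (Set X), (∀ U ∈ B, interior (closure U) = U) ∧
    TopologicalSpace.IsTopologicalBasis B

namespace Expn

variable {Λ : Type*} [DecidableEq Λ]

/-- The candidate basic neighbourhood of `s`: the point `s` together with all two-element sets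
`t ⊇ s` such that `t \ s` avoids the finite set `F`. -/
def pairNhd (s : Expn Λ 2) (F : Finset Λ) : Set (Expn Λ 2) :=
  {t | t = s ∨ (s.1 ⊆ t.1 ∧ t.1.card = 2 ∧ Disjoint (t.1 \ s.1) F)}

/-- The set of all two-element members of `exp_2 λ`. -/
def pairs (Λ : Type*) [DecidableEq Λ] : Set (Expn Λ 2) := {t | t.1.card = 2}

/-- The topology on `exp_2 λ` in which the sets `pairNhd s F` form a neighbourhood base at `s`. -/
abbrev pairTopology (Λ : Type*) [DecidableEq Λ] : TopologicalSpace (Expn Λ 2) where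
  IsOpen U := ∀ s ∈ U, ∃ F : Finset Λ, pairNhd s F ⊆ U
  isOpen_univ _ _ := ⟨∅, subset_univ _⟩
  isOpen_inter U V hU hV s hs := by
    obtain ⟨F, hF⟩ := hU s hs.1
    obtain ⟨G, hG⟩ := hV s hs.2
    refine ⟨F ∪ G, ?_⟩
    rintro t (rfl | ⟨h1, h2, h3⟩)
    · exact hs
    · rw [Finset.disjoint_union_right] at h3
      exact ⟨hF (.inr ⟨h1, h2, h3.1⟩), hG (.inr ⟨h1, h2, h3.2⟩)⟩
  isOpen_sUnion S hS s := by
    rintro ⟨U, hU, hs⟩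
    obtain ⟨F, hF⟩ := hS U hU s hs
    exact ⟨F, hF.trans (subset_sUnion_of_mem hU)⟩

attribute [local instance] pairTopology

theorem isOpen_iff_pairNhd {U : Set (Expn Λ 2)} :
    IsOpen U ↔ ∀ s ∈ U, ∃ F : Finset Λ, pairNhd s F ⊆ U := Iff.rfl

theorem mem_pairNhd_self (s : Expn Λ 2) (F : Finset Λ) : s ∈ pairNhd s F := .inl rfl

theorem pairNhd_of_card_eq_two {s : Expn Λ 2} (hs : s.1.card = 2) (F : Finset Λ) :
    pairNhd s F = {s} := by
  ext t
  refine ⟨?_, fun h => .inl h⟩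
  rintro (h | ⟨h1, h2, -⟩)
  · exact h
  · exact (Subtype.ext (Finset.eq_of_subset_of_card_le h1 (by omega))).symm

theorem isOpen_pairNhd (s : Expn Λ 2) (F : Finset Λ) : IsOpen (pairNhd s F) := by
  rintro t (rfl | ht)
  · exact ⟨F, subset_rfl⟩
  · refine ⟨∅, ?_⟩
    rw [pairNhd_of_card_eq_two ht.2.1, singleton_subset_iff]
    exact .inr ht

theorem pairNhd_mem_nhds (s : Expn Λ 2) (F : Finset Λ) : pairNhd s F ∈ 𝓝 s :=
  (isOpen_pairNhd s F).mem_nhds (mem_pairNhd_self s F)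

theorem exists_pairNhd_subset_of_mem_nhds {s : Expn Λ 2} {U : Set (Expn Λ 2)} (hU : U ∈ 𝓝 s) :
    ∃ F, pairNhd s F ⊆ U := by
  obtain ⟨V, hVU, hV, hs⟩ := mem_nhds_iff.1 hU
  obtain ⟨F, hF⟩ := hV s hs
  exact ⟨F, hF.trans hVU⟩

theorem t2Space_pairTopology : T2Space (Expn Λ 2) := by
  refine ⟨fun s s' hne => ⟨pairNhd s s'.1, pairNhd s' s.1, isOpen_pairNhd _ _, isOpen_pairNhd _ _,
    mem_pairNhd_self _ _, mem_pairNhd_self _ _, ?_⟩⟩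
  rw [Set.disjoint_left]
  have key : ∀ {u v t : Finset Λ}, v ⊆ t → Disjoint (t \ u) v → v ⊆ u := by
    intro u v t hvt hd x hx
    by_contra hxu
    exact Finset.disjoint_left.1 hd (Finset.mem_sdiff.2 ⟨hvt hx, hxu⟩) hx
  rintro t (rfl | ⟨h1, -, h3⟩) (h | ⟨h1', -, h3'⟩)
  · exact hne h
  · exact hne (Subtype.ext ((key subset_rfl h3').antisymm h1'))
  · subst h
    exact hne (Subtype.ext (h1.antisymm (key subset_rfl h3)))
  · exact hne (Subtype.ext ((key h1 h3').antisymm (key h1' h3)))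

theorem continuous_inter_left (a : Expn Λ 2) : Continuous (Expn.inter a) := by
  refine continuous_def.2 fun U _ s hs => ⟨a.1, ?_⟩
  rintro t (rfl | ⟨h1, -, h3⟩)
  · exact hs
  · have : Expn.inter a t = Expn.inter a s := by
      refine Subtype.ext ?_
      ext x
      have hx := @h1 x
      have hd := @Finset.disjoint_left _ (t.1 \ s.1) a.1
      simp only [hd, Finset.mem_sdiff] at h3
      have := @h3 x
      simp only [Expn.inter, Finset.mem_inter]
      tauto
    rw [mem_preimage, this]
    exact hs

section Infinite

variable [Infinite Λ]

theorem pairNhd_inter_pairs_nonempty (s : Expn Λ 2) (F : Finset Λ) :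
    (pairNhd s F ∩ pairs Λ).Nonempty := by
  obtain ⟨u, hu, hcard⟩ :=
    (F ∪ s.1).finite_toSet.infinite_compl.exists_subset_card_eq (2 - s.1.card)
  have hu' : ∀ x ∈ u, x ∉ F ∧ x ∉ s.1 := fun x hx => by simpa using hu hx
  have hdisj : Disjoint s.1 u := Finset.disjoint_right.2 fun x hx => (hu' x hx).2
  have h2 : (s.1 ∪ u).card = 2 := by
    rw [Finset.card_union_of_disjoint hdisj, hcard]
    have := s.2
    omega
  refine ⟨⟨s.1 ∪ u, h2.le⟩, .inr ⟨Finset.subset_union_left, h2, ?_⟩, h2⟩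
  rw [Finset.disjoint_left]
  intro x hx
  simp only [Finset.mem_sdiff, Finset.mem_union] at hx
  exact (hu' x (hx.1.resolve_left hx.2)).1

theorem dense_pairs : Dense (pairs Λ) := by
  refine dense_iff_inter_open.2 fun U hU ⟨s, hs⟩ => ?_
  obtain ⟨F, hF⟩ := hU s hs
  exact (pairNhd_inter_pairs_nonempty s F).mono (inter_subset_inter_left _ hF)

theorem not_continuous_inter :
    ¬ Continuous (fun p : Expn Λ 2 × Expn Λ 2 => Expn.inter p.1 p.2) := by
  intro h
  set e : Expn Λ 2 := ⟨∅, by simp⟩ with he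
  have hee : Expn.inter e e = e := Subtype.ext (Finset.inter_self _)
  have h0 := h.continuousAt (x := (e, e)) (pairNhd_mem_nhds (Expn.inter e e) ∅)
  obtain ⟨V, hV, W, hW, hVW⟩ := mem_nhds_prod_iff.1 h0
  obtain ⟨F, hF⟩ := exists_pairNhd_subset_of_mem_nhds hV
  obtain ⟨G, hG⟩ := exists_pairNhd_subset_of_mem_nhds hW
  obtain ⟨x, hx⟩ := Infinite.exists_notMem_finset (F ∪ G)
  obtain ⟨y, hy⟩ := Infinite.exists_notMem_finset (F ∪ G ∪ {x})
  obtain ⟨z, hz⟩ := Infinite.exists_notMem_finset (F ∪ G ∪ {x, y})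
  simp only [Finset.mem_union, Finset.mem_singleton, Finset.mem_insert, not_or] at hx hy hz
  have hxy : ({x, y} : Finset Λ).card = 2 := Finset.card_pair (Ne.symm hy.2)
  have hxz : ({x, z} : Finset Λ).card = 2 := Finset.card_pair (Ne.symm hz.2.1)
  have h1 : (⟨{x, y}, hxy.le⟩ : Expn Λ 2) ∈ V :=
    hF (.inr ⟨by simp [he], hxy, by simp [he, hx, hy]⟩)
  have h2 : (⟨{x, z}, hxz.le⟩ : Expn Λ 2) ∈ W :=
    hG (.inr ⟨by simp [he], hxz, by simp [he, hx, hz]⟩)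
  have h3 := hVW (mk_mem_prod h1 h2)
  have h4 : ({x, y} ∩ {x, z} : Finset Λ) = {x} := by
    ext w
    simp only [Finset.mem_inter, Finset.mem_insert, Finset.mem_singleton]
    grind
  rw [mem_preimage, hee] at h3
  rcases h3 with h3 | ⟨-, h3, -⟩
  · have := congrArg Subtype.val h3
    simp [Expn.inter, h4, he] at this
  · simp [Expn.inter, h4] at h3

theorem not_semiregularSp_pairTopology : ¬ SemiregularSp (Expn Λ 2) := by
  rintro ⟨B, hreg, hB⟩
  set e : Expn Λ 2 := ⟨∅, by simp⟩ with he
  obtain ⟨U, hUB, heU, hU⟩ :=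
    hB.exists_subset_of_mem_open (mem_pairNhd_self e ∅) (isOpen_pairNhd e ∅)
  obtain ⟨F, hF⟩ := hB.isOpen hUB e heU
  obtain ⟨x, hx⟩ := Infinite.exists_notMem_finset F
  let s : Expn Λ 2 := ⟨{x}, by simp⟩
  have hsub : pairNhd s F ∩ pairs Λ ⊆ U := by
    rintro t ⟨rfl | ⟨h1, h2, h3⟩, ht⟩
    · simp [pairs, s] at ht
    · refine hF (.inr ⟨by simp [he], h2, ?_⟩)
      rw [Finset.disjoint_left] at h3 ⊢
      intro y hy hyF
      by_cases hyx : y = x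
      · exact hx (hyx ▸ hyF)
      · exact h3 (Finset.mem_sdiff.2 ⟨(Finset.mem_sdiff.1 hy).1, by simpa [s] using hyx⟩) hyF
  have hcl : pairNhd s F ⊆ closure U :=
    (dense_pairs.open_subset_closure_inter (isOpen_pairNhd s F)).trans (closure_mono hsub)
  have hsU : s ∈ U := by
    rw [← hreg U hUB]
    exact interior_maximal hcl (isOpen_pairNhd s F) (mem_pairNhd_self s F)
  rcases hU hsU with h | ⟨-, h, -⟩
  · simpa [s, he] using congrArg Subtype.val h
  · simp [s] at h

theorem quasiregularSp_pairTopology : QuasiregularSp (Expn Λ 2) := by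
  have := t2Space_pairTopology (Λ := Λ)
  intro U hU hne
  obtain ⟨t, htU, ht⟩ := dense_pairs.inter_open_nonempty U hU hne
  refine ⟨{t}, ?_, singleton_nonempty t, by simpa using htU, by simpa using htU⟩
  rw [← pairNhd_of_card_eq_two ht ∅]
  exact isOpen_pairNhd t ∅

end Infinite

theorem exists_clusterPt_of_le_principal_pairs {l : Filter (Expn Λ 2)} [hl : l.NeBot]
    (hp : l ≤ 𝓟 (pairs Λ)) : ∃ s, ClusterPt s l := by
  by_contra! hcon
  have hcov : ∀ s : Expn Λ 2, ∃ F, (pairNhd s F)ᶜ ∈ l := by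
    intro s
    have := hcon s
    rw [ClusterPt, not_neBot, ← disjoint_iff, Filter.disjoint_iff] at this
    obtain ⟨U, hU, V, hV, hUV⟩ := this
    obtain ⟨F, hF⟩ := exists_pairNhd_subset_of_mem_nhds hU
    exact ⟨F, mem_of_superset hV (hUV.mono_left hF).subset_compl_left⟩
  have hind : ∀ n, ∀ s : Finset Λ, 3 ≤ s.card + n → ∀ᶠ t in l, ¬ s ⊆ t.1 := by
    intro n
    induction n with
    | zero =>
      intro s hs
      refine Eventually.of_forall fun t hst => ?_
      have := Finset.card_le_card hst
      have := t.2
      omega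
    | succ n ih =>
      intro s hs
      by_cases hs2 : s.card ≤ 2
      · obtain ⟨F, hF⟩ := hcov ⟨s, hs2⟩
        have hins : ∀ᶠ t in l, ∀ x ∈ F \ s, ¬ insert x s ⊆ t.1 := by
          refine (Filter.eventually_all_finset _).2 fun x hx => ih _ ?_
          rw [Finset.card_insert_of_notMem (Finset.mem_sdiff.1 hx).2]
          omega
        filter_upwards [hF, hins, le_principal_iff.1 hp] with t h1 h2 h3 hst
        refine h1 (.inr ⟨hst, h3, Finset.disjoint_left.2 fun x hx hxF => ?_⟩)
        rw [Finset.mem_sdiff] at hx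
        exact h2 x (Finset.mem_sdiff.2 ⟨hxF, hx.2⟩) (Finset.insert_subset hx.1 hst)
      · exact ih s (by omega)
  obtain ⟨t, ht⟩ := (hind 3 ∅ (by simp)).exists
  exact ht (Finset.empty_subset _)

theorem countablyPracompactSp_pairTopology [Infinite Λ] : CountablyPracompactSp (Expn Λ 2) := by
  refine ⟨pairs Λ, dense_pairs, fun B hB hinf => ?_⟩
  have := hinf.cofinite_inf_principal_neBot
  obtain ⟨s, hs⟩ := exists_clusterPt_of_le_principal_pairs (l := cofinite ⊓ 𝓟 B)
    (inf_le_right.trans (principal_mono.2 hB))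
  refine ⟨s, accPt_iff_clusterPt.2 (hs.mono (inf_le_inf_right _ ?_))⟩
  exact le_principal_iff.2 (finite_singleton s).compl_mem_cofinite

theorem hClosedSp_pairTopology [Infinite Λ] : HClosedSp (Expn Λ 2) := by
  intro Y _ _ f hf
  refine isClosed_of_closure_subset fun y hy => ?_
  have : (comap f (𝓝 y) ⊓ 𝓟 (pairs Λ)).NeBot := by
    refine inf_principal_neBot_iff.2 fun U hU => ?_
    obtain ⟨V, hV, hVU⟩ := mem_comap.1 hU
    obtain ⟨W, hWV, hW, hyW⟩ := mem_nhds_iff.1 hV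
    obtain ⟨_, hzW, s, rfl⟩ := mem_closure_iff.1 hy W hW hyW
    exact (dense_pairs.inter_open_nonempty _ (hW.preimage hf.continuous) ⟨s, hzW⟩).mono
      (inter_subset_inter_left _ ((preimage_mono hWV).trans hVU))
  obtain ⟨s, hs⟩ := exists_clusterPt_of_le_principal_pairs
    (l := comap f (𝓝 y) ⊓ 𝓟 (pairs Λ)) inf_le_right
  have hmap : ClusterPt (f s) (𝓝 y) :=
    hs.map hf.continuous.continuousAt ((tendsto_comap (f := f)).mono_left inf_le_left)
  exact ⟨s, eq_of_nhds_neBot hmap⟩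

end Expn

/-- There exists a Hausdorff topology on `exp_2 λ` with `∩` separately but not
jointly continuous, whose space is countably pracompact, H-closed, quasiregular and not
semiregular. -/
theorem exists_pathological_topology_on_exp2
    {Λ : Type*} [DecidableEq Λ] [Infinite Λ] :
    ∃ τ : TopologicalSpace (Expn Λ 2),
      @T2Space _ τ ∧
      (∀ a : Expn Λ 2, Continuous[τ, τ] (Expn.inter a)) ∧
      ¬ @Continuous _ _ (@instTopologicalSpaceProd _ _ τ τ) τ
          (fun p : Expn Λ 2 × Expn Λ 2 => Expn.inter p.1 p.2) ∧
      @CountablyPracompactSp _ τ ∧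
      @HClosedSp _ τ ∧
      @QuasiregularSp _ τ ∧
      ¬ @SemiregularSp _ τ := by
  exact ⟨Expn.pairTopology Λ, Expn.t2Space_pairTopology, Expn.continuous_inter_left,
    Expn.not_continuous_inter, Expn.countablyPracompactSp_pairTopology,
    Expn.hClosedSp_pairTopology, Expn.quasiregularSp_pairTopology,
    Expn.not_semiregularSp_pairTopology⟩
end

section
/- Let n ≥ 3 be a positive integer and λ an infinite cardinal. There exists a Hausdorff topology τ on exp_n λ such that the operation (x, y) ↦ x ∩ y is separately continuous and the space (exp_n λ, τ) is countably pracompact, H-closed, quasiregular, and not semiregular. -/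
open Set Filter Topology TopologicalSpace

universe u v

namespace Expn

variable {Λ : Type*} [DecidableEq Λ] {n : ℕ}

/-- The basic neighbourhood of `x` given by a finite set `F`: the sets that agree with `x` on `F`,
where singletons are discarded if `x` is empty. -/
def basicNhd (x : Expn Λ n) (F : Finset Λ) : Set (Expn Λ n) :=
  {y | y.1 ∩ F = x.1 ∩ F ∧ (x.1 = ∅ → y.1.card ≠ 1)}

lemma self_mem_basicNhd (x : Expn Λ n) (F : Finset Λ) : x ∈ basicNhd x F :=
  ⟨rfl, fun h => by simp [h]⟩

lemma inter_eq_inter_of_subset {s t F G : Finset Λ} (hFG : F ⊆ G) (h : s ∩ G = t ∩ G) :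
    s ∩ F = t ∩ F := by
  rw [← Finset.inter_eq_right.2 hFG, ← Finset.inter_assoc, h, Finset.inter_assoc]

lemma basicNhd_anti (x : Expn Λ n) {F G : Finset Λ} (h : F ⊆ G) :
    basicNhd x G ⊆ basicNhd x F :=
  fun _ hy => ⟨inter_eq_inter_of_subset h hy.1, hy.2⟩

lemma subset_of_inter_union_eq {s t F : Finset Λ} (h : s ∩ (F ∪ t) = t ∩ (F ∪ t)) : t ⊆ s := by
  have h' := inter_eq_inter_of_subset Finset.subset_union_right h
  rw [Finset.inter_self] at h'
  exact Finset.inter_eq_right.1 h'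

lemma basicNhd_union_subset {x y : Expn Λ n} {F : Finset Λ} (hy : y ∈ basicNhd x F) :
    basicNhd y (F ∪ y.1) ⊆ basicNhd x F := by
  intro z hz
  refine ⟨(inter_eq_inter_of_subset Finset.subset_union_left hz.1).trans hy.1, fun hx => ?_⟩
  by_cases h0 : y.1 = ∅
  · exact hz.2 h0
  · have h1 := Finset.card_le_card (subset_of_inter_union_eq hz.1)
    have h2 := hy.2 hx
    have h3 := Finset.card_ne_zero.2 (Finset.nonempty_iff_ne_empty.2 h0)
    omega

/-- The topology of pointwise convergence on `exp_n λ`, refined at `∅` by declaring the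
complement of the set of singletons to be open. -/
@[reducible] def refinedTopology (Λ : Type*) [DecidableEq Λ] (n : ℕ) :
    TopologicalSpace (Expn Λ n) where
  IsOpen U := ∀ x ∈ U, ∃ F, basicNhd x F ⊆ U
  isOpen_univ _ _ := ⟨∅, subset_univ _⟩
  isOpen_inter U V hU hV x hx := by
    obtain ⟨F, hF⟩ := hU x hx.1
    obtain ⟨G, hG⟩ := hV x hx.2
    exact ⟨F ∪ G, subset_inter ((basicNhd_anti x Finset.subset_union_left).trans hF)
      ((basicNhd_anti x Finset.subset_union_right).trans hG)⟩
  isOpen_sUnion S hS x := by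
    rintro ⟨U, hU, hx⟩
    obtain ⟨F, hF⟩ := hS U hU x hx
    exact ⟨F, hF.trans (subset_sUnion_of_mem hU)⟩

lemma isOpen_basicNhd (x : Expn Λ n) (F : Finset Λ) :
    IsOpen[refinedTopology Λ n] (basicNhd x F) :=
  fun y hy => ⟨F ∪ y.1, basicNhd_union_subset hy⟩

lemma mem_nhds_refinedTopology_iff {x : Expn Λ n} {s : Set (Expn Λ n)} :
    s ∈ @nhds _ (refinedTopology Λ n) x ↔ ∃ F, basicNhd x F ⊆ s := by
  let := refinedTopology Λ n
  rw [mem_nhds_iff]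
  constructor
  · rintro ⟨U, hUs, hU, hx⟩
    obtain ⟨F, hF⟩ := hU x hx
    exact ⟨F, hF.trans hUs⟩
  · rintro ⟨F, hF⟩
    exact ⟨_, hF, isOpen_basicNhd x F, self_mem_basicNhd x F⟩

lemma t2Space_refinedTopology : @T2Space _ (refinedTopology Λ n) := by
  let := refinedTopology Λ n
  refine ⟨fun x y hxy => ⟨_, _, isOpen_basicNhd x (x.1 ∪ y.1), isOpen_basicNhd y (x.1 ∪ y.1),
    self_mem_basicNhd _ _, self_mem_basicNhd _ _, ?_⟩⟩
  refine Set.disjoint_left.2 fun z hz hz' => hxy (Subtype.ext ?_)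
  have h := hz.1.symm.trans hz'.1
  rwa [Finset.inter_eq_left.2 Finset.subset_union_left,
    Finset.inter_eq_left.2 Finset.subset_union_right] at h

lemma continuous_inter_refinedTopology (a : Expn Λ n) :
    Continuous[refinedTopology Λ n, refinedTopology Λ n] (inter a) := by
  let := refinedTopology Λ n
  refine ⟨fun U _ x hx => ⟨a.1, fun y hy => ?_⟩⟩
  have h : inter a y = inter a x :=
    Subtype.ext (by simpa only [inter, Finset.inter_comm a.1] using hy.1)
  rwa [mem_preimage, h]

lemma isOpen_singleton_of_card_eq {y : Expn Λ n} (hy : y.1.card = n) :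
    IsOpen[refinedTopology Λ n] {y} := by
  rintro x rfl
  refine ⟨x.1, fun z hz => Subtype.ext ?_⟩
  have h : x.1 ⊆ z.1 := Finset.inter_eq_right.1 (hz.1.trans (Finset.inter_self _))
  exact (Finset.eq_of_subset_of_card_le h (z.2.trans hy.ge)).symm

/-- Every ultrafilter on `exp_n λ` converges pointwise. -/
lemma exists_eventually_inter_eq_s12 (𝒰 : Ultrafilter (Expn Λ n)) :
    ∃ x : Expn Λ n, ∀ F : Finset Λ, ∀ᶠ y in (𝒰 : Filter (Expn Λ n)), y.1 ∩ F = x.1 ∩ F := by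
  set s : Set Λ := {a | ∀ᶠ y in (𝒰 : Filter (Expn Λ n)), a ∈ y.1}
  have key : ∀ F : Finset Λ, (F : Set Λ) ⊆ s → F.card ≤ n := by
    intro F hF
    have h : ∀ᶠ y in (𝒰 : Filter (Expn Λ n)), ∀ a ∈ F, a ∈ y.1 :=
      (Filter.eventually_all_finset F).2 fun a ha => hF ha
    obtain ⟨y, hy⟩ := h.exists
    exact (Finset.card_le_card hy).trans y.2
  have hs : s.Finite := by
    by_contra hs
    obtain ⟨F, hF, hc⟩ := Set.Infinite.exists_subset_card_eq hs (n + 1)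
    have := key F hF
    omega
  refine ⟨⟨hs.toFinset, key _ (by simp)⟩, fun F => ?_⟩
  have h : ∀ᶠ y in (𝒰 : Filter (Expn Λ n)), ∀ a ∈ F, (a ∈ y.1 ↔ a ∈ s) := by
    refine (Filter.eventually_all_finset F).2 fun a _ => ?_
    by_cases ha : a ∈ s
    · exact Filter.Eventually.mono ha fun y hy => iff_of_true hy ha
    · exact (Ultrafilter.eventually_not.2 ha).mono fun y hy => iff_of_false hy ha
  filter_upwards [h] with y hy
  ext a
  simp only [Finset.mem_inter, Set.Finite.mem_toFinset]
  exact and_congr_left (hy a)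

section Infinite

variable [Infinite Λ]

lemma exists_card_eq_mem_basicNhd (hn : 2 ≤ n) (x : Expn Λ n) (F : Finset Λ) :
    ∃ y ∈ basicNhd x F, y.1.card = n := by
  obtain ⟨T, hT, hc⟩ :=
    (Finset.finite_toSet (F ∪ x.1)).infinite_compl.exists_subset_card_eq (n - x.1.card)
  have hd : ∀ a ∈ T, a ∉ F ∧ a ∉ x.1 := fun a ha => by
    simpa [not_or] using hT ha
  have hcard : (x.1 ∪ T).card = n := by
    rw [Finset.card_union_of_disjoint (Finset.disjoint_right.2 fun a ha => (hd a ha).2), hc]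
    have := x.2
    omega
  refine ⟨⟨x.1 ∪ T, hcard.le⟩, ⟨?_, fun _ => by simp only [hcard]; omega⟩, hcard⟩
  ext a
  have := hd a
  simp only [Finset.mem_inter, Finset.mem_union]
  tauto

/-- Every neighbourhood of a singleton `{a}` contains pairs `{a, b}` avoiding any given finite set
that does not contain `a`. -/
lemma exists_mem_basicNhd_of_card_eq_one (hn : 2 ≤ n) {y : Expn Λ n} (hy : y.1.card = 1)
    (F G : Finset Λ) : ∃ z ∈ basicNhd y G, z.1.card = 2 ∧ z.1 ∩ F = y.1 ∩ F := by
  obtain ⟨b, hb⟩ := Infinite.exists_notMem_finset (F ∪ G ∪ y.1)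
  simp only [Finset.mem_union, not_or] at hb
  have hcard : (insert b y.1).card = 2 := by rw [Finset.card_insert_of_notMem hb.2, hy]
  refine ⟨⟨insert b y.1, hcard.le.trans hn⟩,
    ⟨Finset.insert_inter_of_notMem hb.1.2, fun h => ?_⟩, hcard,
    Finset.insert_inter_of_notMem hb.1.1⟩
  simp [h] at hy

lemma countablyPracompactSp_refinedTopology (hn : 2 ≤ n) :
    @CountablyPracompactSp _ (refinedTopology Λ n) := by
  let := refinedTopology Λ n
  refine ⟨{y | y.1.card = n}, fun x => ?_, fun B hB hinf => ?_⟩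
  · refine mem_closure_iff_nhds.2 fun s hs => ?_
    obtain ⟨F, hF⟩ := mem_nhds_refinedTopology_iff.1 hs
    obtain ⟨y, hy, hc⟩ := exists_card_eq_mem_basicNhd hn x F
    exact ⟨y, hF hy, hc⟩
  · have : (cofinite ⊓ 𝓟 B).NeBot := hinf.cofinite_inf_principal_neBot
    set 𝒰 := Ultrafilter.of (cofinite ⊓ 𝓟 B)
    have hle : (𝒰 : Filter (Expn Λ n)) ≤ cofinite ⊓ 𝓟 B := Ultrafilter.of_le _
    have hB' : B ∈ (𝒰 : Filter (Expn Λ n)) := le_principal_iff.1 (hle.trans inf_le_right)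
    obtain ⟨x, hx⟩ := exists_eventually_inter_eq_s12 𝒰
    have hlim : (𝒰 : Filter (Expn Λ n)) ≤ 𝓝 x := by
      intro s hs
      obtain ⟨F, hF⟩ := mem_nhds_refinedTopology_iff.1 hs
      filter_upwards [hx F, hB'] with y hy hyB
      have : y.1.card = n := hB hyB
      exact hF ⟨hy, fun _ => by omega⟩
    have hne : ({x}ᶜ : Set (Expn Λ n)) ∈ (𝒰 : Filter (Expn Λ n)) :=
      hle (mem_inf_of_left (finite_singleton x).compl_mem_cofinite)
    exact ⟨x, 𝒰.neBot.mono
      (le_inf (le_inf hlim (le_principal_iff.2 hne)) (le_principal_iff.2 hB'))⟩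

lemma hClosedSp_refinedTopology (hn : 2 ≤ n) : @HClosedSp _ (refinedTopology Λ n) := by
  let := refinedTopology Λ n
  intro Y _ _ f hf
  refine isClosed_of_closure_subset fun p hp => ?_
  by_contra hpr
  have : (comap f (𝓝 p)).NeBot := comap_neBot_iff_frequently.2 (mem_closure_iff_frequently.1 hp)
  set 𝒰 := Ultrafilter.of (comap f (𝓝 p))
  obtain ⟨x, hx⟩ := exists_eventually_inter_eq_s12 𝒰
  obtain ⟨O, W, hO, hW, hxO, hpW, hd⟩ := t2_separation (fun h : f x = p => hpr ⟨x, h⟩)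
  have hdisj : ∀ z, f z ∈ O → f z ∉ W := fun z h h' => Set.disjoint_left.1 hd h h'
  obtain ⟨F, hF⟩ := (hO.preimage hf.continuous) x hxO
  have hW' : f ⁻¹' W ∈ (𝒰 : Filter (Expn Λ n)) :=
    Ultrafilter.of_le _ (preimage_mem_comap (hW.mem_nhds hpW))
  obtain ⟨y, hyF, hyW⟩ := ((hx F).and hW').exists
  by_cases hy : y.1.card = 1
  · obtain ⟨G, hG⟩ := (hW.preimage hf.continuous) y hyW
    obtain ⟨z, hz, hz2, hzF⟩ := exists_mem_basicNhd_of_card_eq_one hn hy F G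
    exact hdisj z (hF ⟨hzF.trans hyF, fun _ => by omega⟩) (hG hz)
  · exact hdisj y (hF ⟨hyF, fun _ => hy⟩) hyW

lemma quasiregularSp_refinedTopology (hn : 2 ≤ n) :
    @QuasiregularSp _ (refinedTopology Λ n) := by
  let := refinedTopology Λ n
  have : T2Space (Expn Λ n) := t2Space_refinedTopology
  rintro U hU ⟨x, hx⟩
  obtain ⟨F, hF⟩ := hU x hx
  obtain ⟨y, hy, hc⟩ := exists_card_eq_mem_basicNhd hn x F
  have hyU : {y} ⊆ U := Set.singleton_subset_iff.2 (hF hy)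
  exact ⟨{y}, isOpen_singleton_of_card_eq hc, Set.singleton_nonempty y, hyU,
    by rwa [closure_singleton]⟩

lemma not_semiregularSp_refinedTopology (hn : 2 ≤ n) :
    ¬ @SemiregularSp _ (refinedTopology Λ n) := by
  let := refinedTopology Λ n
  rintro ⟨B, hreg, hB⟩
  set e : Expn Λ n := ⟨∅, by simp⟩
  obtain ⟨U, hUB, heU, hUD⟩ := hB.exists_subset_of_mem_open
    (self_mem_basicNhd e ∅) (isOpen_basicNhd e ∅)
  obtain ⟨F, hF⟩ := hB.isOpen hUB e heU
  obtain ⟨a, ha⟩ := Infinite.exists_notMem_finset F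
  set x : Expn Λ n := ⟨{a}, by simp; omega⟩
  have hxF : x.1 ∩ F = ∅ := Finset.singleton_inter_of_notMem ha
  have hsub : basicNhd x F ⊆ closure U := by
    intro y hy
    have hyF : y.1 ∩ F = e.1 ∩ F := by simp [hy.1, hxF, e]
    by_cases h1 : y.1.card = 1
    · refine mem_closure_iff_nhds.2 fun s hs => ?_
      obtain ⟨G, hG⟩ := mem_nhds_refinedTopology_iff.1 hs
      obtain ⟨z, hz, hz2, hzF⟩ := exists_mem_basicNhd_of_card_eq_one hn h1 F G
      exact ⟨z, hG hz, hF ⟨hzF.trans hyF, fun _ => by omega⟩⟩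
    · exact subset_closure (hF ⟨hyF, fun _ => h1⟩)
  have hxU : x ∈ U := by
    rw [← hreg U hUB]
    exact mem_interior.2 ⟨_, hsub, isOpen_basicNhd x F, self_mem_basicNhd x F⟩
  exact (hUD hxU).2 rfl (Finset.card_singleton a)

end Infinite

end Expn

/-- For `n ≥ 3` there exists a Hausdorff topology on `exp_n λ` with `∩`
separately continuous, whose space is countably pracompact, H-closed, quasiregular and not
semiregular. -/
theorem exists_pathological_topology_on_expn
    {Λ : Type*} [DecidableEq Λ] [Infinite Λ] (n : ℕ) (hn : 3 ≤ n) :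
    ∃ τ : TopologicalSpace (Expn Λ n),
      @T2Space _ τ ∧
      (∀ a : Expn Λ n, Continuous[τ, τ] (Expn.inter a)) ∧
      @CountablyPracompactSp _ τ ∧
      @HClosedSp _ τ ∧
      @QuasiregularSp _ τ ∧
      ¬ @SemiregularSp _ τ := by
  have hn' : 2 ≤ n := by omega
  exact ⟨Expn.refinedTopology Λ n, Expn.t2Space_refinedTopology,
    Expn.continuous_inter_refinedTopology, Expn.countablyPracompactSp_refinedTopology hn',
    Expn.hClosedSp_refinedTopology hn', Expn.quasiregularSp_refinedTopology hn',
    Expn.not_semiregularSp_refinedTopology hn'⟩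
end

section
/- Let λ be an infinite cardinal and let τ be a T1 topology on exp_1 λ such that the operation (x, y) ↦ x ∩ y is separately continuous. Then the space (exp_1 λ, τ) is collectionwise normal: for every discrete family {F_s}_{s∈A} of closed subsets of (exp_1 λ, τ) there exists a discrete family {U_s}_{s∈A} of open subsets with F_s ⊆ U_s for every s ∈ A. -/
open Set Filter Topology TopologicalSpace

/-- A family of subsets of a space is discrete if every point has a neighbourhood meeting
at most one member of the family. -/
def IsDiscreteFamily {X : Type*} [TopologicalSpace X] {ι : Type*} (F : ι → Set X) : Prop :=
  ∀ x : X, ∃ V ∈ nhds x, {s : ι | (V ∩ F s).Nonempty}.Subsingleton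

/-- In a `T1` semitopological semilattice `exp_1 λ` every nonempty element is isolated. -/
theorem Expn.isOpen_singleton_of_ne_empty_s13
    {Λ : Type*} [DecidableEq Λ] [TopologicalSpace (Expn Λ 1)] [T1Space (Expn Λ 1)]
    (hsep : ∀ a : Expn Λ 1, Continuous (Expn.inter a)) {x : Expn Λ 1} (hx : x.1 ≠ ∅) :
    IsOpen ({x} : Set (Expn Λ 1)) := by
  obtain ⟨a, ha⟩ : ∃ a, x.1 = {a} :=
    Finset.card_eq_one.1 (le_antisymm x.2 (Finset.card_pos.2 (Finset.nonempty_iff_ne_empty.2 hx)))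
  have hopen : IsOpen (Expn.inter x ⁻¹' {⟨∅, by simp⟩}ᶜ) :=
    isOpen_compl_singleton.preimage (hsep x)
  convert hopen using 1
  ext y
  simp only [mem_singleton_iff, mem_preimage, mem_compl_iff, Expn.inter, Subtype.ext_iff]
  constructor
  · intro hyx
    rwa [hyx, Finset.inter_self]
  · intro hy
    obtain ⟨b, hb⟩ := Finset.nonempty_iff_ne_empty.2 hy
    rw [Finset.mem_inter] at hb
    have hab : b = a := by simpa [ha] using hb.1
    subst hab
    rw [ha]
    exact (Finset.eq_of_subset_of_card_le (Finset.singleton_subset_iff.2 hb.2)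
      (by simpa using y.2)).symm

/-- A space with at most one non-isolated point satisfies the conclusion of collectionwise
normality for every discrete family of sets. -/
theorem IsDiscreteFamily.exists_isOpen_superset_of_isolated
    {X : Type*} [TopologicalSpace X] {z : X} (hz : ∀ x, x ≠ z → IsOpen ({x} : Set X))
    {ι : Type*} {F : ι → Set X} (hF : IsDiscreteFamily F) :
    ∃ U : ι → Set X, (∀ s, IsOpen (U s)) ∧ (∀ s, F s ⊆ U s) ∧ IsDiscreteFamily U := by
  obtain ⟨V, hV, hVF⟩ := hF z
  have hzV : z ∈ V := mem_of_mem_nhds hV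
  have meets : ∀ s x, x ∈ V → x ∈ F s ∨ (z ∈ F s ∧ x ∈ V) → (V ∩ F s).Nonempty := by
    rintro s x hx (h | h)
    exacts [⟨x, hx, h⟩, ⟨z, hzV, h.1⟩]
  refine ⟨fun s => {x | x ∈ F s ∨ (z ∈ F s ∧ x ∈ V)}, fun s => ?_, fun s x hx => Or.inl hx,
    fun x => ?_⟩
  · rw [isOpen_iff_mem_nhds]
    intro x hx
    by_cases hxz : x = z
    · subst hxz
      have hs : x ∈ F s := hx.elim id And.left
      exact mem_of_superset hV fun y hy => Or.inr ⟨hs, hy⟩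
    · exact mem_of_superset ((hz x hxz).mem_nhds rfl) (singleton_subset_iff.2 hx)
  · by_cases hxz : x = z
    · refine ⟨V, hxz ▸ hV, ?_⟩
      rintro s ⟨y, hy, hys⟩ t ⟨w, hw, hwt⟩
      exact hVF (meets s y hy hys) (meets t w hw hwt)
    · refine ⟨{x}, (hz x hxz).mem_nhds rfl, ?_⟩
      intro s hs t ht
      replace hs := singleton_inter_nonempty.1 hs
      replace ht := singleton_inter_nonempty.1 ht
      by_cases hxV : x ∈ V
      · exact hVF (meets s x hxV hs) (meets t x hxV ht)
      · obtain ⟨W, hW, hWF⟩ := hF x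
        have hxW := mem_of_mem_nhds hW
        exact hWF ⟨x, hxW, hs.resolve_right fun h => hxV h.2⟩
          ⟨x, hxW, ht.resolve_right fun h => hxV h.2⟩

/-- Every `T1` semitopological semilattice topology on `exp_1 λ` is
collectionwise normal. -/
theorem exp1_collectionwiseNormal
    {Λ : Type*} [DecidableEq Λ] [Infinite Λ]
    [TopologicalSpace (Expn Λ 1)] [T1Space (Expn Λ 1)]
    (hsep : ∀ a : Expn Λ 1, Continuous (Expn.inter a)) :
    ∀ {ι : Type*} (F : ι → Set (Expn Λ 1)), (∀ s, IsClosed (F s)) → IsDiscreteFamily F →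
      ∃ U : ι → Set (Expn Λ 1), (∀ s, IsOpen (U s)) ∧ (∀ s, F s ⊆ U s) ∧
        IsDiscreteFamily U := by
  intro ι F _ hF
  exact hF.exists_isOpen_superset_of_isolated (z := ⟨∅, by simp⟩) fun x hx =>
    Expn.isOpen_singleton_of_ne_empty_s13 hsep fun h => hx (Subtype.ext h)
end

section
/- Let n be a positive integer and λ an infinite cardinal. Every T1 topology τ on exp_n λ for which the operation (x, y) ↦ x ∩ y is jointly continuous is regular (T3). -/
open Set Filter Topology TopologicalSpace

/-- In a `T1` topology with continuous intersection, the elements whose trace on a fixed `a` is a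
fixed `b` form an open set, since the traces on `a` lie in a finite, hence discrete, set. -/
theorem Expn.isOpen_setOf_inter_eq {Λ : Type*} [DecidableEq Λ] {n : ℕ}
    [TopologicalSpace (Expn Λ n)] [T1Space (Expn Λ n)]
    (hjoint : Continuous fun p : Expn Λ n × Expn Λ n => Expn.inter p.1 p.2) (a b : Expn Λ n) :
    IsOpen {z : Expn Λ n | Expn.inter z a = b} := by
  have hcont : Continuous fun z : Expn Λ n => Expn.inter z a :=
    hjoint.comp (continuous_id.prodMk continuous_const)
  have hfin : {c : Expn Λ n | c.1 ⊆ a.1 ∧ c ≠ b}.Finite := by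
    refine Set.Finite.of_finite_image (f := Subtype.val) ?_ Subtype.val_injective.injOn
    refine a.1.powerset.finite_toSet.subset ?_
    rintro _ ⟨c, hc, rfl⟩
    exact Finset.mem_coe.2 (Finset.mem_powerset.2 hc.1)
  convert (hfin.isClosed.isOpen_compl).preimage hcont using 1
  ext z
  have hsub : (Expn.inter z a).1 ⊆ a.1 := Finset.inter_subset_right
  simp only [mem_ofPred_eq, mem_preimage, mem_compl_iff, hsub, true_and, not_not]

/-- In a `T1` topology with continuous intersection, every point of the closure of `V` is the
intersection of two elements of `V`. -/
theorem Expn.exists_inter_eq_of_mem_closure {Λ : Type*} [DecidableEq Λ] {n : ℕ}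
    [TopologicalSpace (Expn Λ n)] [T1Space (Expn Λ n)]
    (hjoint : Continuous fun p : Expn Λ n × Expn Λ n => Expn.inter p.1 p.2)
    {V : Set (Expn Λ n)} {y : Expn Λ n} (hy : y ∈ closure V) :
    ∃ v ∈ V, ∃ w ∈ V, Expn.inter v w = y := by
  have inter_self : Expn.inter y y = y := Subtype.ext (Finset.inter_self _)
  obtain ⟨w, hwy, hwV⟩ :=
    mem_closure_iff.1 hy _ (Expn.isOpen_setOf_inter_eq hjoint y y) inter_self
  have hyw : Expn.inter y w = y :=
    (Subtype.ext (Finset.inter_comm _ _) : Expn.inter y w = Expn.inter w y).trans hwy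
  obtain ⟨v, hvw, hvV⟩ := mem_closure_iff.1 hy _ (Expn.isOpen_setOf_inter_eq hjoint w y) hyw
  exact ⟨v, hvV, w, hwV, hvw⟩

/-- Every `T1` topological semilattice topology on `exp_n λ` is regular (T3). -/
theorem topological_semilattice_expn_regular
    {Λ : Type*} [DecidableEq Λ] [Infinite Λ] (n : ℕ) (hn : 0 < n)
    [TopologicalSpace (Expn Λ n)] [T1Space (Expn Λ n)]
    (hjoint : Continuous fun p : Expn Λ n × Expn Λ n => Expn.inter p.1 p.2) :
    T3Space (Expn Λ n) := by
  have : RegularSpace (Expn Λ n) := by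
    refine RegularSpace.of_exists_mem_nhds_isClosed_subset fun x U hU => ?_
    have hxx : Expn.inter x x = x := Subtype.ext (Finset.inter_self _)
    have hpre : (fun p : Expn Λ n × Expn Λ n => Expn.inter p.1 p.2) ⁻¹' U ∈ 𝓝 (x, x) :=
      hjoint.continuousAt.preimage_mem_nhds (by simpa only [hxx] using hU)
    rw [nhds_prod_eq] at hpre
    obtain ⟨V, hV, hVU⟩ := Filter.mem_prod_same_iff.1 hpre
    refine ⟨closure V, mem_of_superset hV subset_closure, isClosed_closure, fun y hy => ?_⟩
    obtain ⟨v, hv, w, hw, rfl⟩ := Expn.exists_inter_eq_of_mem_closure hjoint hy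
    exact hVU (Set.mk_mem_prod hv hw)
  exact { }
end

section
/- Let n be a positive integer and let λ = ω be the countably infinite cardinal. Every T1 topology τ on exp_n ω for which the operation (x, y) ↦ x ∩ y is jointly continuous is perfectly normal, i.e., the space (exp_n ω, τ) is normal and every closed subset is a Gδ-set. -/
open Set Filter Topology TopologicalSpace

namespace Expn

variable {Λ : Type*} [DecidableEq Λ] {n : ℕ}

/-- An element of `exp_n λ` has only finitely many subsets. -/
theorem finite_setOf_subset (a : Expn Λ n) : {c : Expn Λ n | c.1 ⊆ a.1}.Finite := by
  have h : {c : Expn Λ n | c.1 ⊆ a.1} = Subtype.val ⁻¹' (a.1.powerset : Set (Finset Λ)) := by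
    ext c
    simp
  rw [h]
  exact a.1.powerset.finite_toSet.preimage Subtype.val_injective.injOn

variable [TopologicalSpace (Expn Λ n)] [T1Space (Expn Λ n)]

/-- The fibres of a continuous translation `z ↦ z ∩ a` are open. -/
theorem isOpen_setOf_inter_eq_s15 {a : Expn Λ n} (ha : Continuous fun z => inter z a)
    (b : Expn Λ n) : IsOpen {z | inter z a = b} := by
  have hfin : ({c : Expn Λ n | c.1 ⊆ a.1} \ {b}).Finite := (finite_setOf_subset a).sdiff
  convert (hfin.isClosed.preimage ha).isOpen_compl using 1
  ext z
  have hza : (inter z a).1 ⊆ a.1 := Finset.inter_subset_right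
  simp only [mem_ofPred_eq, mem_compl_iff, mem_preimage, Set.mem_sdiff, mem_singleton_iff, hza,
    true_and, not_not]

/-- Every point of the closure of `V` is the intersection of two members of `V`. -/
theorem exists_inter_eq_of_mem_closure_s15 (h : ∀ a : Expn Λ n, Continuous fun z => inter z a)
    {V : Set (Expn Λ n)} {y : Expn Λ n} (hy : y ∈ closure V) :
    ∃ v ∈ V, ∃ w ∈ V, inter v w = y := by
  rw [mem_closure_iff] at hy
  obtain ⟨w, hwy, hw⟩ := hy _ (isOpen_setOf_inter_eq_s15 (h y) y) (Subtype.ext (Finset.inter_self _))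
  have hsub : y.1 ⊆ w.1 := Finset.inter_eq_right.1 (congrArg Subtype.val hwy)
  obtain ⟨v, hvw, hv⟩ := hy _ (isOpen_setOf_inter_eq_s15 (h w) y)
    (Subtype.ext (Finset.inter_eq_left.2 hsub))
  exact ⟨v, hv, w, hw, hvw⟩

/-- A `T1` topological semilattice `exp_n λ` is regular. -/
theorem regularSpace (h : Continuous fun p : Expn Λ n × Expn Λ n => inter p.1 p.2) :
    RegularSpace (Expn Λ n) := by
  refine .of_exists_mem_nhds_isClosed_subset fun x U hU => ?_
  have hxx : inter x x = x := Subtype.ext (Finset.inter_self _)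
  have hpre : (fun p : Expn Λ n × Expn Λ n => inter p.1 p.2) ⁻¹' U ∈ 𝓝 (x, x) :=
    h.continuousAt.preimage_mem_nhds (by simpa only [hxx] using hU)
  rw [nhds_prod_eq, mem_prod_same_iff] at hpre
  obtain ⟨V, hV, hVU⟩ := hpre
  refine ⟨closure V, mem_of_superset hV subset_closure, isClosed_closure, fun y hy => ?_⟩
  obtain ⟨v, hv, w, hw, rfl⟩ := exists_inter_eq_of_mem_closure_s15
    (fun a => h.comp (continuous_id.prodMk continuous_const)) hy
  exact hVU (mk_mem_prod hv hw)

end Expn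

/-- For a countably infinite `λ = ω`, every `T1` topological semilattice
topology on `exp_n ω` is perfectly normal: the space is normal and every closed set is
a `Gδ`-set. -/
theorem topological_semilattice_expn_omega_perfectlyNormal
    {Λ : Type*} [DecidableEq Λ] [Countable Λ] [Infinite Λ] (n : ℕ) (hn : 0 < n)
    [TopologicalSpace (Expn Λ n)] [T1Space (Expn Λ n)]
    (hjoint : Continuous fun p : Expn Λ n × Expn Λ n => Expn.inter p.1 p.2) :
    NormalSpace (Expn Λ n) ∧ ∀ C : Set (Expn Λ n), IsClosed C → IsGδ C := by
  have := Expn.regularSpace hjoint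
  refine ⟨inferInstance, fun C _ => ?_⟩
  simpa using (Set.to_countable Cᶜ).isGδ_compl
end

section
/- Let n be a positive integer and λ an infinite cardinal, and let τ be a Hausdorff feebly compact topology on exp_n λ such that the operation (x, y) ↦ x ∩ y is separately continuous. Then for every open neighbourhood U of the zero ∅ in (exp_n λ, τ) there exist finitely many nonzero elements x₁, …, x_i ∈ exp_n λ such that every subset of λ of cardinality exactly n belongs to U ∪ ↑x₁ ∪ … ∪ ↑x_i. -/
open Set Filter Topology TopologicalSpace

/-- In a feebly compact `T₁` space, a set of isolated points without accumulation points is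
finite. -/
theorem FeeblyCompactSp.finite_of_isolated {X : Type*} [TopologicalSpace X] [T1Space X]
    (hfc : FeeblyCompactSp X) {S : Set X} (hS : ∀ x ∈ S, IsOpen ({x} : Set X))
    (hacc : ∀ z, ∃ V, IsOpen V ∧ z ∈ V ∧ (V ∩ S).Finite) : S.Finite := by
  have hclosed : IsOpen Sᶜ := by
    rw [isOpen_iff_forall_mem_open]
    intro z hz
    obtain ⟨V, hV, hzV, hfin⟩ := hacc z
    exact ⟨V \ (V ∩ S), fun y hy hyS => hy.2 ⟨hy.1, hyS⟩, hV.sdiff hfin.isClosed,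
      hzV, fun h => hz h.2⟩
  have hcover : (insert Sᶜ ((fun x => ({x} : Set X)) '' S)).Finite := by
    refine hfc _ ?_ ?_ ?_
    · rintro W (rfl | ⟨x, hx, rfl⟩)
      exacts [hclosed, hS x hx]
    · refine eq_univ_of_forall fun z => ?_
      by_cases hz : z ∈ S
      · exact ⟨{z}, Or.inr ⟨z, hz, rfl⟩, rfl⟩
      · exact ⟨Sᶜ, Or.inl rfl, hz⟩
    · intro z
      obtain ⟨V, hV, hzV, hfin⟩ := hacc z
      refine ⟨V, hV.mem_nhds hzV, ?_⟩
      refine Set.Finite.of_finite_image (f := Subtype.val) ?_ Subtype.val_injective.injOn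
      refine ((hfin.image fun x => ({x} : Set X)).insert Sᶜ).subset ?_
      rintro _ ⟨⟨W, hW⟩, ⟨y, hyW, hyV⟩, rfl⟩
      rcases hW with rfl | ⟨x, hx, rfl⟩
      · exact Or.inl rfl
      · obtain rfl : y = x := hyW
        exact Or.inr ⟨y, ⟨hyV, hx⟩, rfl⟩
  exact Set.Finite.of_finite_image (hcover.subset (subset_insert _ _))
    singleton_injective.injOn

/-- In a Hausdorff feebly compact semitopological semilattice `exp_n λ`, for
every open neighbourhood `U` of the zero `∅` there are finitely many nonzero elements
`x₁, …, x_i` such that every subset of `λ` of cardinality exactly `n` lies in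
`U ∪ ↑x₁ ∪ … ∪ ↑x_i`. -/
theorem top_rank_covered_by_nhd_of_zero_and_finitely_many_upsets
    {Λ : Type*} [DecidableEq Λ] [Infinite Λ] (n : ℕ) (hn : 0 < n)
    [TopologicalSpace (Expn Λ n)] [T2Space (Expn Λ n)]
    (hfc : FeeblyCompactSp (Expn Λ n))
    (hsep : ∀ a : Expn Λ n, Continuous (Expn.inter a)) :
    ∀ U : Set (Expn Λ n), IsOpen U → (⟨∅, by simp⟩ : Expn Λ n) ∈ U →
      ∃ t : Finset (Expn Λ n), (∀ x ∈ t, x.1 ≠ ∅) ∧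
        ∀ y : Expn Λ n, y.1.card = n → y ∈ U ∪ ⋃ x ∈ t, Expn.up x := by
  intro U hU h0
  set A : Set (Expn Λ n) := {y | y.1.card = n ∧ y ∉ U}
  have hisol : ∀ x ∈ A, IsOpen ({x} : Set (Expn Λ n)) := by
    intro x hx
    convert Expn.isOpen_up hsep x using 1
    ext y
    refine ⟨fun h => h ▸ Finset.Subset.refl _, fun h => Subtype.ext ?_⟩
    exact (Finset.eq_of_subset_of_card_le h (y.2.trans_eq hx.1.symm)).symm
  obtain ⟨M, hM⟩ := zorn_subset
    {M : Set (Expn Λ n) | M ⊆ A ∧ M.PairwiseDisjoint Subtype.val} (by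
      intro c hc hchain
      refine ⟨⋃₀ c, ⟨sUnion_subset fun s hs => (hc hs).1, ?_⟩, fun s hs => subset_sUnion_of_mem hs⟩
      exact (pairwiseDisjoint_sUnion hchain.directedOn).2 fun s hs => (hc hs).2)
  have hMfin : M.Finite := by
    refine hfc.finite_of_isolated (fun x hx => hisol x (hM.prop.1 hx)) fun z => ?_
    by_cases hz : z.1 = ∅
    · refine ⟨U, hU, ?_, ?_⟩
      · rwa [show z = ⟨∅, by simp⟩ from Subtype.ext hz]
      · convert Set.finite_empty
        exact eq_empty_of_forall_notMem fun y hy => (hM.prop.1 hy.2).2 hy.1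
    · refine ⟨Expn.up z, Expn.isOpen_up hsep z, Finset.Subset.refl _, ?_⟩
      refine Set.Subsingleton.finite fun a ha b hb => hM.prop.2.eq ha.2 hb.2 fun hab => ?_
      exact hz (Finset.subset_empty.1 (hab ha.1 hb.1))
  let single : Λ → Expn Λ n := fun i => ⟨{i}, by rw [Finset.card_singleton]; exact hn⟩
  refine ⟨hMfin.toFinset.biUnion fun m => m.1.image single, ?_, ?_⟩
  · intro x hx
    simp only [Finset.mem_biUnion, Finset.mem_image] at hx
    obtain ⟨_, _, i, _, rfl⟩ := hx
    exact Finset.singleton_ne_empty i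
  · intro y hy
    by_cases hyU : y ∈ U
    · exact Or.inl hyU
    right
    obtain ⟨m, hm, i, him, hiy⟩ : ∃ m ∈ M, ∃ i ∈ m.1, i ∈ y.1 := by
      by_contra! hdisj
      have hyM : y ∈ M := by
        refine hM.le_of_ge (y := insert y M) ⟨insert_subset ⟨hy, hyU⟩ hM.prop.1, ?_⟩
          (subset_insert y M) (mem_insert y M)
        refine hM.prop.2.insert fun m hm _ => ?_
        exact (Finset.disjoint_left.2 (hdisj m hm)).symm
      obtain ⟨i, hi⟩ := Finset.card_pos.1 (hy ▸ hn)
      exact hdisj y hyM i hi hi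
    refine mem_iUnion₂.2 ⟨single i, ?_, Finset.singleton_subset_iff.2 hiy⟩
    exact Finset.mem_biUnion.2 ⟨m, hMfin.mem_toFinset.2 hm, Finset.mem_image_of_mem _ him⟩
end

section
/- Let n be a positive integer and λ an infinite cardinal. The topological space (exp_n λ, τ_c^n) is sequentially compact: every sequence in exp_n λ has a subsequence converging in τ_c^n. -/
open Set Filter Topology TopologicalSpace

/-- Every sequence of finite sets has a subsequence that eventually decides the membership of
each point. -/
theorem exists_strictMono_eventually_mem_or_notMem {Λ : Type*} (u : ℕ → Finset Λ) :
    ∃ φ : ℕ → ℕ, StrictMono φ ∧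
      ∀ a, (∀ᶠ k in atTop, a ∈ u (φ k)) ∨ ∀ᶠ k in atTop, a ∉ u (φ k) := by
  classical
  let S : Set Λ := ⋃ k, (u k : Set Λ)
  have : Countable S := (countable_iUnion fun k => (u k).countable_toSet).to_subtype
  obtain ⟨g, φ, hφ, hg⟩ :=
    SeqCompactSpace.tendsto_subseq fun (k : ℕ) (a : S) => decide (a.1 ∈ u k)
  refine ⟨φ, hφ, fun a => ?_⟩
  by_cases ha : a ∈ S
  · have h := tendsto_pi_nhds.1 hg ⟨a, ha⟩
    rw [nhds_discrete, tendsto_pure] at h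
    cases hga : g ⟨a, ha⟩ with
    | true => exact Or.inl (h.mono fun k hk => by simpa [hga] using hk)
    | false => exact Or.inr (h.mono fun k hk => by simpa [hga] using hk)
  · exact Or.inr (Eventually.of_forall fun k hk => ha (mem_iUnion.2 ⟨φ k, hk⟩))

/-- Pointwise eventual agreement of membership implies convergence in `τ_c^n`. -/
theorem tendsto_tauC_of_eventually_mem_iff {Λ ι : Type*} [DecidableEq Λ] {n : ℕ} {l : Filter ι}
    {v : ι → Expn Λ n} {x : Expn Λ n} (h : ∀ a, ∀ᶠ k in l, (a ∈ (v k).1 ↔ a ∈ x.1)) :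
    Tendsto v l (@nhds _ (tauC Λ n) x) := by
  have hup (y : Expn Λ n) : ∀ᶠ k in l, (v k ∈ Expn.up y ↔ x ∈ Expn.up y) := by
    filter_upwards [(Finset.eventually_all y.1).2 fun a _ => h a] with k hk
    exact forall₂_congr hk
  refine tendsto_nhds_generateFrom_iff.2 ?_
  rintro _ (⟨y, rfl⟩ | ⟨y, rfl⟩) hx
  · exact (hup y).mono fun k hk => hk.2 hx
  · exact (hup y).mono fun k hk => mt hk.1 hx

/-- `(exp_n λ, τ_c^n)` is sequentially compact: every sequence has a
subsequence converging in `τ_c^n`. -/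
theorem tauC_seqCompact
    {Λ : Type*} [DecidableEq Λ] [Infinite Λ] (n : ℕ) (hn : 0 < n) :
    ∀ u : ℕ → Expn Λ n, ∃ (x : Expn Λ n) (φ : ℕ → ℕ), StrictMono φ ∧
      Filter.Tendsto (u ∘ φ) Filter.atTop (@nhds _ (tauC Λ n) x) := by
  intro u
  obtain ⟨φ, hφ, hdec⟩ := exists_strictMono_eventually_mem_or_notMem fun k => (u k).1
  let X : Set Λ := {a | ∀ᶠ k in atTop, a ∈ (u (φ k)).1}
  have hcard (T : Finset Λ) (hT : (T : Set Λ) ⊆ X) : T.card ≤ n := by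
    obtain ⟨k, hk⟩ := ((Finset.eventually_all T).2 fun a ha => hT ha).exists
    exact (Finset.card_le_card hk).trans (u (φ k)).2
  have hX : X.Finite := by
    by_contra hinf
    obtain ⟨T, hT, hTn⟩ := Set.Infinite.exists_subset_card_eq hinf (n + 1)
    have := hcard T hT
    omega
  refine ⟨⟨hX.toFinset, hcard _ hX.coe_toFinset.subset⟩, φ, hφ,
    tendsto_tauC_of_eventually_mem_iff fun a => ?_⟩
  simp only [Set.Finite.mem_toFinset]
  by_cases ha : a ∈ X
  · exact Eventually.mono ha fun k hk => iff_of_true hk ha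
  · exact ((hdec a).resolve_left ha).mono fun k hk => iff_of_false hk ha
end
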